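/- arXiv:1412.7611 — 4 statements merged into one kernel-verified Lean document; each statement's English description precedes it below -/
import Mathlib

section
/- For every field F and every prime number p, the absolute Galois group G_F = Gal(F_s/F) of F has the vanishing triple Massey product property with respect to 𝔽_p. -/
/-- Continuity of a map from a topological space to `ZMod p`, the latter regarded
as a discrete space: all fibers are open. -/
def Cts {G : Type*} [TopologicalSpace G] {p : ℕ} (f : G → ZMod p) : Prop :=
  ∀ x : ZMod p, IsOpen (f ⁻¹' {x})

/-- `f` is a homomorphism from `G` to the additive group `ZMod p`. -/
def IsHom1 {G : Type*} [Group G] {p : ℕ} (f : G → ZMod p) : Prop :=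
  ∀ σ τ : G, f (σ * τ) = f σ + f τ

/-- The coboundary `∂f` of a 1-cochain `f`: `∂f(σ,τ) = f σ + f τ - f (σ*τ)`. -/
def cob {G : Type*} [Group G] {p : ℕ} (f : G → ZMod p) : G → G → ZMod p :=
  fun σ τ => f σ + f τ - f (σ * τ)

/-- The cup product of two 1-cochains: `(f ∪ g)(σ,τ) = f σ * g τ`. -/
def cup {G : Type*} {p : ℕ} (f g : G → ZMod p) : G → G → ZMod p :=
  fun σ τ => f σ * g τ

/-- A topological group `G` has the vanishing triple Massey product property with
respect to `𝔽_p`: whenever the triple Massey product of three continuous homomorphisms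
`G → 𝔽_p` is defined (i.e. admits a defining system), it vanishes (i.e. for some
defining system the resulting 2-cocycle is a coboundary of a continuous 1-cochain). -/
def HasVanishingTripleMassey (G : Type*) [Group G] [TopologicalSpace G] (p : ℕ) : Prop :=
  ∀ χ₁ χ₂ χ₃ : G → ZMod p,
    IsHom1 χ₁ → IsHom1 χ₂ → IsHom1 χ₃ → Cts χ₁ → Cts χ₂ → Cts χ₃ →
    (∃ D₁₂ D₂₃ : G → ZMod p, Cts D₁₂ ∧ Cts D₂₃ ∧
      cob D₁₂ = cup χ₁ χ₂ ∧ cob D₂₃ = cup χ₂ χ₃) →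
    ∃ D₁₂ D₂₃ E : G → ZMod p, Cts D₁₂ ∧ Cts D₂₃ ∧ Cts E ∧
      cob D₁₂ = cup χ₁ χ₂ ∧ cob D₂₃ = cup χ₂ χ₃ ∧
      cob E = fun σ τ => χ₁ σ * D₂₃ τ + D₁₂ σ * χ₃ τ

namespace TripleMassey

open Finset

/-- The data through which Kummer theory enters: a discrete `G`-module `M`, divisible by `p`, whose
`p`-torsion is a trivial `G`-module identified with `ZMod p`, and which satisfies Hilbert 90 for
all open subgroups of `G`. -/
structure KummerModule (p : ℕ) (G M : Type*) [Group G] [TopologicalSpace G] [AddCommGroup M]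
    [DistribMulAction G M] where
  /-- The inclusion of the `p`-torsion. -/
  ι : ZMod p →+ M
  ι_injective : Function.Injective ι
  exists_ι_eq : ∀ m : M, p • m = 0 → ∃ x, ι x = m
  smul_ι : ∀ (g : G) (x : ZMod p), g • ι x = ι x
  isLocallyConstant_smul : ∀ m : M, IsLocallyConstant fun g : G => g • m
  exists_nsmul_eq : ∀ m : M, ∃ n : M, p • n = m
  hilbert90 : ∀ U : Subgroup G, IsOpen (U : Set G) → ∀ w : G → M, IsLocallyConstant w →
    (∀ g ∈ U, ∀ h ∈ U, w (g * h) = w g + g • w h) → ∃ y, ∀ g ∈ U, w g = g • y - y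

theorem cts_iff {G : Type*} [TopologicalSpace G] {p : ℕ} {f : G → ZMod p} :
    Cts f ↔ IsLocallyConstant f := by
  refine ⟨fun h s => ?_, fun h x => h {x}⟩
  rw [← Set.biUnion_of_singleton s, Set.preimage_iUnion₂]
  exact isOpen_biUnion fun x _ => h x

section Sums

variable {p : ℕ} [Fact p.Prime] {M : Type*} [AddCommGroup M]

theorem sum_range_add_cast (f : ZMod p → M) (a : ZMod p) :
    ∑ k ∈ range p, f (a + k) = ∑ k ∈ range p, f k := by
  have key : ∀ f : ZMod p → M, ∑ k ∈ range p, f k = ∑ x, f x := by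
    intro f
    refine Finset.sum_bij' (fun k _ => (k : ZMod p)) (fun x _ => x.val) ?_ ?_ ?_ ?_ ?_
    · simp
    · intro x _
      simpa using x.val_lt
    · intro k hk
      exact ZMod.val_cast_of_lt (by simpa using hk)
    · simp
    · simp
  rw [key (fun x => f (a + x)), key f]
  exact Equiv.sum_comp (Equiv.addLeft a) f

theorem sum_range_add_mul (f : ZMod p → M) (n c : ℕ) :
    ∑ k ∈ range (n + p * c), f k = ∑ k ∈ range n, f k + c • ∑ k ∈ range p, f k := by
  induction c with
  | zero => simp
  | succ c ih =>
    rw [mul_add, mul_one, ← add_assoc, sum_range_add, ih]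
    have := sum_range_add_cast f (n + p * c : ℕ)
    push_cast at this ⊢
    rw [this]
    module

/-- The carry of the addition of the canonical representatives of `a` and `b`. -/
def carry (a b : ZMod p) : ℕ := (a.val + b.val) / p

theorem val_add_val (a b : ZMod p) : a.val + b.val = (a + b).val + p * carry a b := by
  rw [ZMod.val_add, carry, Nat.mod_add_div]

theorem carry_le_one (a b : ZMod p) : carry a b ≤ 1 := by
  have ha := a.val_lt
  have hb := b.val_lt
  rw [carry, ← Nat.lt_succ_iff, Nat.div_lt_iff_lt_mul (Fact.out : p.Prime).pos]
  omega

/-- The cochain that trivializes the triple Massey product, in terms of a splitting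
`E (x + 1) (y + 1) - E x y = α x - γ y`. -/
def splitting (α : ZMod p → M) (E : ZMod p → ZMod p → M) (a b : ZMod p) (i j : ℕ) : M :=
  ∑ k ∈ range i, E (a + k) b - ∑ l ∈ range j, E (a + i) (b + l + 1) + j • ∑ k ∈ range i, α (a + k)

theorem splitting_add (α γ : ZMod p → M) (E : ZMod p → ZMod p → M)
    (hE : ∀ x y, E (x + 1) (y + 1) = E x y + α x - γ y) (i j i' j' : ℕ) :
    splitting α E 0 0 i j + splitting α E i j i' j' - splitting α E 0 0 (i + i') (j + j') =
      -(i' • ∑ l ∈ range j, γ l) - j' • ∑ k ∈ range i, α k := by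
  induction i' with
  | zero =>
    simp only [splitting, sum_range_add, sum_range_zero]
    push_cast
    simp only [zero_add, add_zero, ← add_assoc]
    module
  | succ n ih =>
    have h1 : ∀ m : ℕ, ∑ l ∈ range m, E ((i + n : ℕ) + 1) (0 + l + 1) =
        ∑ l ∈ range m, E (i + n : ℕ) (0 + l + 1) + E (i + n : ℕ) 0 - E (i + n : ℕ) m +
          m • α (i + n : ℕ) - ∑ l ∈ range m, γ l := by
      intro m
      induction m with
      | zero => simp
      | succ m ihm =>
        rw [sum_range_succ, ihm, hE, sum_range_succ, sum_range_succ]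
        push_cast
        simp only [zero_add]
        module
    have h2 : ∀ m : ℕ, ∑ l ∈ range m, E ((i + n : ℕ) + 1) (j + l + 1) =
        ∑ l ∈ range m, E (i + n : ℕ) (j + l + 1) + E (i + n : ℕ) j - E (i + n : ℕ) (j + m : ℕ) +
          m • α (i + n : ℕ) - ∑ l ∈ range m, γ (j + l) := by
      intro m
      induction m with
      | zero => simp
      | succ m ihm =>
        rw [sum_range_succ, ihm, hE, sum_range_succ, sum_range_succ]
        push_cast
        simp only [add_assoc]
        module
    have h3 := h1 (j + j')
    have h4 := h2 j'
    rw [sum_range_add (fun l : ℕ => γ l)] at h3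
    simp only [splitting, ← add_assoc, sum_range_succ] at ih h3 h4 ⊢
    push_cast at ih h3 h4 ⊢
    simp only [zero_add, ← add_assoc] at ih h3 h4 ⊢
    rw [h3, h4]
    linear_combination (norm := module) (1 : ℤ) • ih

theorem sum_range_splitting_left (α γ : ZMod p → M) (E : ZMod p → ZMod p → M)
    (hE : ∀ x y, E (x + 1) (y + 1) = E x y + α x - γ y) (n : ℕ) :
    ∑ l ∈ range p, E n l =
      ∑ l ∈ range p, E 0 l + p • ∑ k ∈ range n, α k - n • ∑ l ∈ range p, γ l := by
  induction n with
  | zero => simp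
  | succ n ih =>
    have h1 := sum_range_add_cast (fun l => E (n + 1) l) 1
    simp only [add_comm (1 : ZMod p), hE, sum_sub_distrib, sum_add_distrib, ih, sum_const,
      card_range] at h1
    rw [Nat.cast_add, Nat.cast_one, ← h1, sum_range_succ]
    module

theorem sum_range_splitting_right (α γ : ZMod p → M) (E : ZMod p → ZMod p → M)
    (hE : ∀ x y, E (x + 1) (y + 1) = E x y + α x - γ y) (n : ℕ) :
    ∑ k ∈ range p, E k n =
      ∑ k ∈ range p, E k 0 - p • ∑ l ∈ range n, γ l + n • ∑ k ∈ range p, α k := by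
  have h := sum_range_splitting_left (fun x => -γ x) (fun x => -α x) (fun x y => E y x)
    (fun x y => by rw [hE]; abel) n
  simp only [sum_neg_distrib] at h
  rw [h]
  module

theorem splitting_add_mul (α γ : ZMod p → M) (E : ZMod p → ZMod p → M)
    (hE : ∀ x y, E (x + 1) (y + 1) = E x y + α x - γ y)
    {b : M} (hα : ∑ k ∈ range p, α k = b) (hγ : ∑ l ∈ range p, γ l = b) (n m c d : ℕ) :
    splitting α E 0 0 (n + p * c) (m + p * d) = splitting α E 0 0 n m + c • ∑ k ∈ range p, E k 0
      - d • ∑ l ∈ range p, E 0 l + (d * n) • b + ((m + p * d) * c) • b := by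
  have h1 := sum_range_add_mul (fun x => E x 0) n c
  have h2 := sum_range_add_mul (fun y => E n (y + 1)) m d
  have h3 := sum_range_add_mul α n c
  have h4 := sum_range_add_cast (fun l => E n l) 1
  simp only [add_comm (1 : ZMod p)] at h4
  rw [h4, sum_range_splitting_left α γ E hE, hγ] at h2
  rw [hα] at h3
  simp only [splitting, zero_add, Nat.cast_add, Nat.cast_mul, CharP.cast_eq_zero, zero_mul,
    add_zero, h1, h2, h3]
  module

/-- Iterated partial sums of `α`. -/
def doubleSum (α : ZMod p → M) (a : ZMod p) (n : ℕ) : M :=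
  ∑ k ∈ range n, ∑ m ∈ range k, α (a + m)

theorem doubleSum_add (α : ZMod p → M) (i i' : ℕ) :
    doubleSum α 0 (i + i') = doubleSum α 0 i + i' • ∑ k ∈ range i, α k + doubleSum α i i' := by
  simp only [doubleSum, sum_range_add, zero_add, Nat.cast_add, sum_add_distrib, sum_const,
    card_range]
  module

theorem doubleSum_cast (α : ZMod p → M) (i : ℕ) :
    doubleSum α i p = doubleSum α 0 p + i • ∑ k ∈ range p, α k - p • ∑ k ∈ range i, α k := by
  have h1 := doubleSum_add α i p
  have h2 := doubleSum_add α p i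
  simp only [CharP.cast_eq_zero] at h2
  rw [add_comm p i, h1] at h2
  linear_combination (norm := module) (1 : ℤ) • h2

end Sums

section Hom

variable {p : ℕ} {G : Type*} [Group G] {χ : G → ZMod p}

theorem _root_.IsHom1.map_one (h : IsHom1 χ) : χ 1 = 0 := by
  simpa using h 1 1

theorem _root_.IsHom1.map_inv (h : IsHom1 χ) (g : G) : χ g⁻¹ = -χ g := by
  have := h g g⁻¹
  rw [mul_inv_cancel, h.map_one] at this
  exact (neg_eq_of_add_eq_zero_right this.symm).symm

theorem _root_.IsHom1.map_pow (h : IsHom1 χ) (g : G) (n : ℕ) : χ (g ^ n) = n * χ g := by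
  induction n with
  | zero => simp [h.map_one]
  | succ n ih => rw [pow_succ, h, ih]; push_cast; ring

theorem _root_.IsHom1.exists_eq_one [Fact p.Prime] (h : IsHom1 χ) {g : G} (hg : χ g ≠ 0) :
    ∃ n : ℕ, χ (g ^ n) = 1 :=
  ⟨(χ g)⁻¹.val, by rw [h.map_pow, ZMod.natCast_zmod_val, inv_mul_cancel₀ hg]⟩

theorem _root_.IsHom1.sub {ψ : G → ZMod p} (h : IsHom1 χ) (h' : IsHom1 ψ) : IsHom1 (χ - ψ) := by
  intro g g'
  simp only [Pi.sub_apply, h g, h' g]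
  ring

/-- The kernel of a homomorphism to `ZMod p`. -/
def _root_.IsHom1.ker (h : IsHom1 χ) : Subgroup G where
  carrier := {g | χ g = 0}
  one_mem' := h.map_one
  mul_mem' {a b} ha hb := by
    simp only [Set.mem_ofPred_eq] at ha hb ⊢
    rw [h, ha, hb, add_zero]
  inv_mem' {a} ha := by
    simp only [Set.mem_ofPred_eq] at ha ⊢
    rw [h.map_inv, ha, neg_zero]

/-- A vector fixed by the kernel of `π` has its orbit parametrized by the values of `π`. -/
theorem exists_orbit_param {X M : Type*} [AddCommGroup X] [AddCommGroup M] [DistribMulAction G M]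
    {π : G → X} (hπ : ∀ g h, π (g * h) = π g + π h) (hs : Function.Surjective π) {m : M}
    (hm : ∀ g, π g = 0 → g • m = m) :
    ∃ a : X → M, a 0 = m ∧ ∀ g x, g • a x = a (π g + x) := by
  have h1 : π 1 = 0 := by simpa using hπ 1 1
  have key : ∀ g h, π g = π h → g • m = h • m := by
    intro g h hgh
    have h2 : π h⁻¹ = -π h := by
      have := hπ h h⁻¹
      rw [mul_inv_cancel, h1] at this
      exact (neg_eq_of_add_eq_zero_right this.symm).symm
    have h3 := hm (h⁻¹ * g) (by rw [hπ, h2, hgh, neg_add_cancel])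
    rw [mul_smul, inv_smul_eq_iff] at h3
    exact h3
  choose s hsec using hs
  refine ⟨fun x => s x • m, hm _ (hsec 0), fun g x => ?_⟩
  rw [smul_smul]
  exact key _ _ (by rw [hπ, hsec, hsec])

end Hom

theorem _root_.IsLocallyConstant.map₂ {X Y Z W : Type*} [TopologicalSpace X] {f : X → Y} {g : X → Z}
    (hf : IsLocallyConstant f) (hg : IsLocallyConstant g) (φ : Y → Z → W) :
    IsLocallyConstant fun x => φ (f x) (g x) :=
  hf.comp₂ hg φ

/-- The conclusion of the vanishing of a triple Massey product follows from a trivialization of a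
symmetrized cocycle. -/
theorem massey_of_symmetrized {p : ℕ} {G : Type*} [Group G] [TopologicalSpace G]
    {χ₁ χ₂ χ₃ D₂₁ D₂₃ E : G → ZMod p} (h₁ : IsHom1 χ₁) (h₂ : IsHom1 χ₂)
    (c₁ : IsLocallyConstant χ₁) (c₂ : IsLocallyConstant χ₂) (cD₂₁ : IsLocallyConstant D₂₁)
    (cD₂₃ : IsLocallyConstant D₂₃) (cE : IsLocallyConstant E)
    (hD₂₁ : cob D₂₁ = cup χ₂ χ₁) (hD₂₃ : cob D₂₃ = cup χ₂ χ₃)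
    (hE : ∀ g g', cob E g g' = χ₁ g' * D₂₃ g + χ₃ g' * D₂₁ g - χ₁ g' * χ₃ g' * χ₂ g) :
    ∃ D₁₂ D₂₃ E : G → ZMod p, Cts D₁₂ ∧ Cts D₂₃ ∧ Cts E ∧
      cob D₁₂ = cup χ₁ χ₂ ∧ cob D₂₃ = cup χ₂ χ₃ ∧
      cob E = fun σ τ => χ₁ σ * D₂₃ τ + D₁₂ σ * χ₃ τ := by
  refine ⟨fun g => -(χ₁ g * χ₂ g) - D₂₁ g, D₂₃, fun g => -(χ₁ g * D₂₃ g) - E g,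
    cts_iff.2 ((c₁.map₂ c₂ (fun a b => -(a * b))).map₂ cD₂₁ (· - ·)), cts_iff.2 cD₂₃,
    cts_iff.2 ((c₁.map₂ cD₂₃ (fun a b => -(a * b))).map₂ cE (· - ·)), ?_, hD₂₃, ?_⟩
  · ext g g'
    have a := congrFun₂ hD₂₁ g g'
    simp only [cob, cup, h₁ g, h₂ g] at a ⊢
    linear_combination -a
  · ext g g'
    have a := congrFun₂ hD₂₃ g g'
    have b := hE g g'
    simp only [cob, cup, h₁ g] at a b ⊢
    linear_combination -b - (χ₁ g + χ₁ g') * a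

namespace KummerModule

variable {p : ℕ} {G M : Type*} [Group G] [TopologicalSpace G] [AddCommGroup M]
  [DistribMulAction G M]

theorem hilbert90_ker (K : KummerModule p G M) {χ : G → ZMod p} (h : IsHom1 χ) (c : IsLocallyConstant χ) {w : G → M}
    (cw : IsLocallyConstant w)
    (hw : ∀ g, χ g = 0 → ∀ h, χ h = 0 → w (g * h) = w g + g • w h) :
    ∃ y, ∀ g, χ g = 0 → w g = g • y - y :=
  K.hilbert90 h.ker (c.isOpen_fiber 0) w cw hw

theorem hilbert90_top (K : KummerModule p G M) {w : G → M} (cw : IsLocallyConstant w)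
    (hw : ∀ g h, w (g * h) = w g + g • w h) : ∃ y, ∀ g, w g = g • y - y := by
  obtain ⟨y, hy⟩ := K.hilbert90 ⊤ isOpen_univ w cw fun g _ h _ => hw g h
  exact ⟨y, fun g => hy g trivial⟩

variable (K : KummerModule p G M)

theorem nsmul_ι (x : ZMod p) : p • K.ι x = 0 := by
  rw [← map_nsmul, nsmul_eq_mul, CharP.cast_eq_zero, zero_mul, map_zero]

theorem ι_mul [NeZero p] (x y : ZMod p) : K.ι (x * y) = x.val • K.ι y := by
  rw [← map_nsmul, nsmul_eq_mul, ZMod.natCast_zmod_val]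

theorem exists_ι_comp {u : G → M} (cu : IsLocallyConstant u) (hu : ∀ g, p • u g = 0) :
    ∃ D : G → ZMod p, IsLocallyConstant D ∧ ∀ g, K.ι (D g) = u g := by
  choose D hD using fun g => K.exists_ι_eq (u g) (hu g)
  refine ⟨D, IsLocallyConstant.desc D K.ι ?_ K.ι_injective, hD⟩
  convert cu using 1
  exact funext hD

/-- A 2-cocycle with values in `ZMod p` which becomes a coboundary in `M` is a coboundary. -/
theorem exists_cob_eq {f : G → G → ZMod p} {u : G → M} (cu : IsLocallyConstant u)
    (hu : ∀ g g', K.ι (f g g') = u g + g • u g' - u (g * g')) :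
    ∃ E : G → ZMod p, IsLocallyConstant E ∧ cob E = f := by
  obtain ⟨y, hy⟩ := K.hilbert90_top (w := fun g => p • u g) (cu.comp (p • ·)) fun g h => by
    have := congrArg (p • ·) (hu g h)
    simp only [K.nsmul_ι, smul_sub, smul_add] at this
    rw [smul_comm g p]
    exact (sub_eq_zero.1 this.symm).symm
  obtain ⟨z, rfl⟩ := K.exists_nsmul_eq y
  obtain ⟨E, cE, hE⟩ := K.exists_ι_comp (u := fun g => u g - (g • z - z))
    (cu.map₂ (K.isLocallyConstant_smul z) (fun a b => a - (b - z))) fun g => by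
      rw [smul_sub, hy, smul_comm g p, smul_sub, sub_self]
  refine ⟨E, cE, ?_⟩
  ext g g'
  refine K.ι_injective ?_
  have h := K.smul_ι g (E g')
  rw [hE, smul_sub, smul_sub, smul_smul] at h
  rw [cob, map_sub, map_add, hE, hE, hE, hu]
  generalize g • z = a, g • u g' = b, (g * g') • z = c, g' • z = d at *
  linear_combination (norm := module) (-1 : ℤ) • h

theorem exists_kummer {χ : G → ZMod p} (h : IsHom1 χ) (c : IsLocallyConstant χ) :
    ∃ β : M, ∀ g, g • β = β + K.ι (χ g) := by
  obtain ⟨y, hy⟩ := K.hilbert90_top (w := fun g => K.ι (χ g)) (c.comp K.ι) fun g g' => by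
    rw [h, map_add, K.smul_ι]
  exact ⟨y, fun g => by rw [hy]; abel⟩

end KummerModule

section Carry

variable {p : ℕ} [Fact p.Prime]

theorem carry_zero_left (a : ZMod p) : carry 0 a = 0 := by
  simp [carry, Nat.div_eq_of_lt a.val_lt]

theorem carry_zero_right (a : ZMod p) : carry a 0 = 0 := by
  simp [carry, Nat.div_eq_of_lt a.val_lt]

end Carry

namespace KummerModule

variable {p : ℕ} [Fact p.Prime] {G M : Type*} [Group G] [TopologicalSpace G] [AddCommGroup M]
  [DistribMulAction G M] (K : KummerModule p G M)

/-- If `ψ ∪ χ` is trivial and `ψ` is the Kummer character of `β`, then `p • β` is a norm from the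
kernel of `χ`. -/
theorem exists_norm {χ ψ D : G → ZMod p} (hχ : IsHom1 χ) (cχ : IsLocallyConstant χ)
    (cD : IsLocallyConstant D) (hD : cob D = cup ψ χ) {β : M}
    (hβ : ∀ g, g • β = β + K.ι (ψ g)) {σ : G} (hσ : χ σ = 1) :
    ∃ α : ZMod p → M, (∀ g x, g • α x = α (χ g + x)) ∧ ∑ k ∈ range p, α k = p • β := by
  obtain ⟨w₀, hw₀⟩ : ∃ w₀ : G → M, w₀ = fun g => (χ g).val • β - K.ι (D g) := ⟨_, rfl⟩
  have cw₀ : IsLocallyConstant w₀ := by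
    rw [hw₀]
    exact cχ.map₂ cD fun a b => a.val • β - K.ι b
  have hcob₀ : ∀ g h, w₀ (g * h) = w₀ g + g • w₀ h - carry (χ g) (χ h) • p • β := by
    intro g h
    have h1 : K.ι (D g + D h - D (g * h)) = (χ h).val • K.ι (ψ g) := by
      rw [← K.ι_mul, mul_comm (χ h)]
      exact congrArg K.ι (congrFun₂ hD g h)
    have h2 := val_add_val (χ g) (χ h)
    rw [← hχ] at h2
    have h3 : (((χ g).val + (χ h).val : ℕ) : ℤ) • β =
        (((χ (g * h)).val + p * carry (χ g) (χ h) : ℕ) : ℤ) • β := by rw [h2]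
    rw [map_sub, map_add] at h1
    simp only [hw₀, smul_sub, K.smul_ι, smul_comm g, hβ]
    push_cast at h3
    linear_combination (norm := module) (1 : ℤ) • h1 - (1 : ℤ) • h3
  obtain ⟨y, hy⟩ := K.hilbert90_ker hχ cχ cw₀ fun g hg h hh => by
    rw [hcob₀, hg, carry_zero_left, zero_smul, sub_zero]
  obtain ⟨w, hw⟩ : ∃ w : G → M, w = fun g => w₀ g - (g • y - y) := ⟨_, rfl⟩
  have hker : ∀ g, χ g = 0 → w g = 0 := fun g hg => by simp only [hw, hy g hg, sub_self]
  have hcob : ∀ g h, w (g * h) = w g + g • w h - carry (χ g) (χ h) • p • β := by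
    intro g h
    simp only [hw, hcob₀ g h, smul_sub, smul_smul]
    abel
  have hfix : ∀ u, χ u = 0 → u • w σ = w σ := by
    intro u hu
    have hu' : χ (σ⁻¹ * u * σ) = 0 := by
      rw [hχ, hχ, hχ.map_inv, hu]
      ring
    have h1 := hcob u σ
    have h2 := hcob σ (σ⁻¹ * u * σ)
    rw [hker _ hu', hu', carry_zero_right, ← mul_assoc, mul_inv_cancel_left] at h2
    rw [hker u hu, hu, carry_zero_left, h2] at h1
    simpa using h1.symm
  have hsurj : Function.Surjective χ := fun x =>
    ⟨σ ^ x.val, by rw [hχ.map_pow, hσ, mul_one, ZMod.natCast_zmod_val]⟩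
  obtain ⟨α, hα₀, hα⟩ := exists_orbit_param hχ hsurj hfix
  refine ⟨α, hα, ?_⟩
  have hp := (Fact.out : p.Prime).two_le
  have hpow : ∀ k : ℕ, χ (σ ^ k) = k := fun k => by rw [hχ.map_pow, hσ, mul_one]
  have hsucc : ∀ k : ℕ, w (σ ^ (k + 1)) = w (σ ^ k) + α k - carry (k : ZMod p) 1 • p • β := by
    intro k
    rw [pow_succ, hcob, hpow, hσ, ← hα₀, hα, hpow, add_zero]
  have hval : (1 : ZMod p).val = 1 := by
    have := ZMod.val_cast_of_lt (n := p) (a := 1) (by omega)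
    simpa using this
  have hsum : ∀ k < p, w (σ ^ k) = ∑ l ∈ range k, α l := by
    intro k hk
    induction k with
    | zero => simpa using hker 1 hχ.map_one
    | succ k ih =>
      rw [hsucc, ih (by omega), sum_range_succ, carry, ZMod.val_cast_of_lt (by omega), hval,
        Nat.div_eq_of_lt hk, zero_smul, sub_zero]
  have hlast := hsucc (p - 1)
  have hp1 : p - 1 + 1 = p := by omega
  rw [hp1, hker _ (by rw [hpow, CharP.cast_eq_zero]), hsum _ (by omega), ← sum_range_succ
    (fun l : ℕ => α l), hp1, carry, ZMod.val_cast_of_lt (by omega), hval, hp1,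
    Nat.div_self (by omega), one_smul] at hlast
  exact (sub_eq_zero.1 hlast.symm)

/-- Explicit cochains with coboundary `ψ ∪ χ`. -/
theorem exists_cob_eq_cup {χ ψ : G → ZMod p} (hχ : IsHom1 χ) (cχ : IsLocallyConstant χ) {β : M}
    (hβ : ∀ g, g • β = β + K.ι (ψ g)) {α : ZMod p → M} (hα : ∀ g x, g • α x = α (χ g + x))
    (hsum : ∑ k ∈ range p, α k = p • β) {η : M}
    (hη : ∀ g, g • p • η =
      p • η + (χ g).val • p • β - p • ∑ k ∈ range (χ g).val, α k) :
    ∃ D : G → ZMod p, IsLocallyConstant D ∧ cob D = cup ψ χ ∧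
      ∀ g, K.ι (D g) = (χ g).val • β - ∑ k ∈ range (χ g).val, α k - (g • η - η) := by
  obtain ⟨D, cD, hD⟩ := K.exists_ι_comp
    (u := fun g => (χ g).val • β - ∑ k ∈ range (χ g).val, α k - (g • η - η))
    (cχ.map₂ (K.isLocallyConstant_smul η)
      fun a b => a.val • β - ∑ k ∈ range a.val, α k - (b - η)) fun g => by
      have := hη g
      rw [smul_comm] at this
      generalize g • η = a at *
      linear_combination (norm := module) (-1 : ℤ) • this
  refine ⟨D, cD, ?_, hD⟩
  ext g h
  refine K.ι_injective ?_
  have h2 := val_add_val (χ g) (χ h)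
  rw [← hχ] at h2
  have h3 : (((χ g).val + (χ h).val : ℕ) : ℤ) • β =
      (((χ (g * h)).val + p * carry (χ g) (χ h) : ℕ) : ℤ) • β := by rw [h2]
  have h4 := sum_range_add_mul α (χ (g * h)).val (carry (χ g) (χ h))
  rw [← h2, hsum, sum_range_add] at h4
  have h5 : g • ∑ k ∈ range (χ h).val, α k = ∑ k ∈ range (χ h).val, α ((χ g).val + k : ℕ) := by
    rw [smul_sum]
    simp only [hα, Nat.cast_add, ZMod.natCast_zmod_val]
  have h6 := K.smul_ι g (D h)
  simp only [hD, smul_sub, smul_comm g, hβ, h5, smul_smul] at h6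
  rw [cup, mul_comm, K.ι_mul, cob, map_sub, map_add, hD, hD, hD]
  generalize (g * h) • η = a, g • η = b, h • η = c at *
  push_cast at h3 h4 h6
  linear_combination (norm := module) (1 : ℤ) • h3 - (1 : ℤ) • h4 - (1 : ℤ) • h6

variable {p : ℕ} [Fact p.Prime] {G M : Type*} [Group G] [TopologicalSpace G] [AddCommGroup M]
  [DistribMulAction G M]

theorem massey_of_dependent (K : KummerModule p G M) {χ₁ χ₂ χ₃ D : G → ZMod p}
    (h₁ : IsHom1 χ₁) (h₂ : IsHom1 χ₂) (c₁ : IsLocallyConstant χ₁) (c₂ : IsLocallyConstant χ₂)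
    (cD : IsLocallyConstant D) (hD : cob D = cup χ₂ χ₁) {σ : G} (hσ : χ₁ σ = 1) {k : ZMod p}
    (hk : ∀ g, χ₃ g = k * χ₁ g) :
    ∃ D₁₂ D₂₃ E : G → ZMod p, Cts D₁₂ ∧ Cts D₂₃ ∧ Cts E ∧
      cob D₁₂ = cup χ₁ χ₂ ∧ cob D₂₃ = cup χ₂ χ₃ ∧
      cob E = fun σ τ => χ₁ σ * D₂₃ τ + D₁₂ σ * χ₃ τ := by
  obtain ⟨β, hβ⟩ := K.exists_kummer h₂ c₂
  obtain ⟨α, hα, hsum⟩ := K.exists_norm h₁ c₁ cD hD hβ hσ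
  have hsmul : ∀ g n, g • doubleSum α 0 n = doubleSum α (χ₁ g).val n := by
    intro g n
    simp only [doubleSum, smul_sum, hα, ZMod.natCast_zmod_val, zero_add]
  obtain ⟨η, hη⟩ := K.exists_nsmul_eq (doubleSum α 0 p)
  obtain ⟨D₂₁, cD₂₁, hD₂₁, hι⟩ := K.exists_cob_eq_cup h₁ c₁ hβ hα hsum (η := η) fun g => by
    rw [hη, hsmul, doubleSum_cast, hsum]
  obtain ⟨E, cE, hE⟩ := K.exists_cob_eq
    (f := fun g g' => χ₁ g' * D₂₁ g + χ₁ g' * D₂₁ g - χ₁ g' * (χ₁ g' * χ₂ g))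
    (u := fun g => 2 • doubleSum α 0 (χ₁ g).val + (χ₁ g).val • p • β - (2 * (χ₁ g).val) • η -
      ((χ₁ g).val * (χ₁ g).val) • β)
    (c₁.comp fun a => 2 • doubleSum α 0 a.val + a.val • p • β - (2 * a.val) • η -
      (a.val * a.val) • β) fun g h => by
    have e1 := val_add_val (χ₁ g) (χ₁ h)
    rw [← h₁] at e1
    have e2 := doubleSum_add α (χ₁ g).val (χ₁ h).val
    have e3 := doubleSum_add α (p * carry (χ₁ g) (χ₁ h)) (χ₁ (g * h)).val
    rw [add_comm (p * _), ← e1] at e3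
    have e4 : doubleSum α 0 (p * carry (χ₁ g) (χ₁ h)) =
        carry (χ₁ g) (χ₁ h) • p • η ∧
        ∑ k ∈ range (p * carry (χ₁ g) (χ₁ h)), α k = carry (χ₁ g) (χ₁ h) • p • β ∧
        carry (χ₁ g) (χ₁ h) * carry (χ₁ g) (χ₁ h) = carry (χ₁ g) (χ₁ h) := by
      rcases Nat.le_one_iff_eq_zero_or_eq_one.1 (carry_le_one (χ₁ g) (χ₁ h)) with hc | hc <;>
      simp [hc, doubleSum, hsum, hη]
    obtain ⟨e4, e5, e6⟩ := e4
    have e7 : ((p * carry (χ₁ g) (χ₁ h) : ℕ) : ZMod p) = 0 := by simp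
    rw [e7, e4, e5] at e3
    simp only [map_sub, map_add, K.ι_mul, hι, smul_sub, smul_add, smul_comm g, hβ, hsmul]
    generalize g • η = a, χ₁ (g * h) = x, carry (χ₁ g) (χ₁ h) = c,
      (χ₁ g).val = i, (χ₁ h).val = j at *
    generalize x.val = n at *
    rw [e2] at e3
    generalize doubleSum α 0 n = A, doubleSum α 0 i = B, doubleSum α i j = C,
      ∑ k ∈ range i, α k = S at *
    have e3' : C = c • p • η + n • c • p • β + A - B - j • S := by
      rw [← e3]; abel
    rw [e3']
    have e1' : (n : ℤ) = i + j - p * c := by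
      have : ((i + j : ℕ) : ℤ) = (n + p * c : ℕ) := by rw [e1]
      push_cast at this
      linarith
    have e6' : (c : ℤ) * c = c := by exact_mod_cast e6
    have e8 := K.nsmul_ι (χ₂ g)
    linear_combination (norm := skip) (-(j : ℤ)) • e8
    match_scalars
    all_goals push_cast
    all_goals try simp only [e1']
    all_goals first | ring1 | linear_combination (p : ℤ) ^ 2 * e6'
  refine massey_of_symmetrized (E := fun g => k * E g) (D₂₃ := fun g => k * D₂₁ g) h₁ h₂ c₁ c₂
    cD₂₁ (cD₂₁.comp (k * ·)) (cE.comp (k * ·)) hD₂₁ ?_ fun g h => ?_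
  · ext g h
    have := congrFun₂ hD₂₁ g h
    simp only [cob, cup, hk] at this ⊢
    linear_combination k * this
  · have := congrFun₂ hE g h
    simp only [cob, hk] at this ⊢
    linear_combination k * this

theorem massey_of_independent (K : KummerModule p G M) {χ₁ χ₂ χ₃ D D' : G → ZMod p}
    (h₁ : IsHom1 χ₁) (h₂ : IsHom1 χ₂) (h₃ : IsHom1 χ₃)
    (c₁ : IsLocallyConstant χ₁) (c₂ : IsLocallyConstant χ₂) (c₃ : IsLocallyConstant χ₃)
    (cD : IsLocallyConstant D) (hD : cob D = cup χ₂ χ₁)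
    (cD' : IsLocallyConstant D') (hD' : cob D' = cup χ₂ χ₃)
    {σ τ : G} (hσ₁ : χ₁ σ = 1) (hσ₃ : χ₃ σ = 0) (hτ₁ : χ₁ τ = 0) (hτ₃ : χ₃ τ = 1) :
    ∃ D₁₂ D₂₃ E : G → ZMod p, Cts D₁₂ ∧ Cts D₂₃ ∧ Cts E ∧
      cob D₁₂ = cup χ₁ χ₂ ∧ cob D₂₃ = cup χ₂ χ₃ ∧
      cob E = fun σ τ => χ₁ σ * D₂₃ τ + D₁₂ σ * χ₃ τ := by
  obtain ⟨β, hβ⟩ := K.exists_kummer h₂ c₂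
  obtain ⟨α, hα, hαsum⟩ := K.exists_norm h₁ c₁ cD hD hβ hσ₁
  obtain ⟨γ, hγ, hγsum⟩ := K.exists_norm h₃ c₃ cD' hD' hβ hτ₃
  obtain ⟨e, he⟩ := K.hilbert90_ker (h₁.sub h₃)
    (w := fun g => ∑ k ∈ range (χ₁ g).val, (α k - γ k)) (c₁.map₂ c₃ (· - ·))
    (c₁.comp fun a => ∑ k ∈ range a.val, (α k - γ k)) fun g hg h hh => by
      have hg' : χ₃ g = χ₁ g := (sub_eq_zero.1 hg).symm
      have h1 := sum_range_add_mul (fun x => α x - γ x) (χ₁ (g * h)).val (carry (χ₁ g) (χ₁ h))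
      rw [h₁ g h, ← val_add_val, sum_sub_distrib (s := range p), hαsum, hγsum, sub_self, smul_zero,
        add_zero, ← h₁ g h, sum_range_add] at h1
      rw [← h1, smul_sum]
      simp only [smul_sub, hα, hγ, hg', Nat.cast_add, ZMod.natCast_zmod_val]
  have hfix : ∀ g, (χ₁ g, χ₃ g) = 0 → g • e = e := by
    intro g hg
    rw [Prod.mk_eq_zero] at hg
    have := he g (by simp [hg])
    rw [hg.1, ZMod.val_zero, range_zero, sum_empty] at this
    exact (sub_eq_zero.1 this.symm)
  obtain ⟨E₀, hE₀, hE₀'⟩ := exists_orbit_param (π := fun g => (χ₁ g, χ₃ g))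
    (fun g h => by rw [h₁ g h, h₃ g h]; rfl)
    (fun x => ⟨σ ^ x.1.val * τ ^ x.2.val, by
      simp [h₁ _ _, h₃ _ _, h₁.map_pow, h₃.map_pow, hσ₁, hσ₃, hτ₁, hτ₃]⟩) hfix
  obtain ⟨ε, hε⟩ : ∃ ε : ZMod p → ZMod p → M, ε = fun x y => E₀ (x, y) := ⟨_, rfl⟩
  have hsmul : ∀ g x y, g • ε x y = ε (χ₁ g + x) (χ₃ g + y) := by
    intro g x y
    rw [hε]
    exact hE₀' g (x, y)
  have hε₀ : ε 0 0 = e := by rw [hε]; exact hE₀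
  have hval : (1 : ZMod p).val = 1 := by
    have := ZMod.val_cast_of_lt (n := p) (a := 1) (Fact.out : p.Prime).one_lt
    simpa using this
  have hrel : ∀ x y, ε (x + 1) (y + 1) = ε x y + α x - γ y := by
    intro x y
    have h1 := he (σ * τ) (by simp [h₁ _ _, h₃ _ _, hσ₁, hσ₃, hτ₁, hτ₃])
    rw [h₁, hσ₁, hτ₁, add_zero, hval, sum_range_one, Nat.cast_zero, ← hε₀, hsmul, h₁, h₃, hσ₁, hτ₁,
      hσ₃, hτ₃] at h1
    have h2 := congrArg (fun m => (σ ^ x.val * τ ^ y.val) • m) h1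
    simp only [smul_sub, hsmul, hα, hγ, h₁ _ _, h₃ _ _, h₁.map_pow, h₃.map_pow, hσ₁, hσ₃, hτ₁, hτ₃,
      ZMod.natCast_zmod_val, mul_one, mul_zero, add_zero, zero_add] at h2
    linear_combination (norm := module) (-1 : ℤ) • h2
  obtain ⟨η₁, hη₁⟩ := K.exists_nsmul_eq (-∑ l ∈ range p, ε 0 l)
  obtain ⟨η₃, hη₃⟩ := K.exists_nsmul_eq (∑ k ∈ range p, ε k 0)
  obtain ⟨D₂₁, cD₂₁, hD₂₁, hι₁⟩ := K.exists_cob_eq_cup h₁ c₁ hβ hα hαsum (η := η₁) fun g => by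
    have h1 := sum_range_splitting_left α γ ε hrel (χ₁ g).val
    have h2 := sum_range_add_cast (fun l => ε (χ₁ g) l) (χ₃ g)
    simp only [ZMod.natCast_zmod_val] at h1
    simp only [hη₁, smul_neg, smul_sum, hsmul, add_zero]
    rw [h2, h1, hγsum, smul_sum]
    module
  obtain ⟨D₂₃, cD₂₃, hD₂₃, hι₃⟩ := K.exists_cob_eq_cup h₃ c₃ hβ hγ hγsum (η := η₃) fun g => by
    have h1 := sum_range_splitting_right α γ ε hrel (χ₃ g).val
    have h2 := sum_range_add_cast (fun k => ε k (χ₃ g)) (χ₁ g)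
    simp only [ZMod.natCast_zmod_val] at h1
    simp only [hη₃, smul_sum, hsmul, add_zero]
    rw [h2, h1, hαsum, smul_sum]
    module
  obtain ⟨E, cE, hE⟩ := K.exists_cob_eq
    (f := fun g g' => χ₁ g' * D₂₃ g + χ₃ g' * D₂₁ g - χ₁ g' * (χ₃ g' * χ₂ g))
    (u := fun g => splitting α ε 0 0 (χ₁ g).val (χ₃ g).val - (χ₁ g).val • η₃ - (χ₃ g).val • η₁ -
      ((χ₁ g).val * (χ₃ g).val) • β)
    (c₁.map₂ c₃ fun a b => splitting α ε 0 0 a.val b.val - a.val • η₃ - b.val • η₁ -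
      (a.val * b.val) • β) fun g h => by
    have e1 := val_add_val (χ₁ g) (χ₁ h)
    rw [← h₁] at e1
    have e3 := val_add_val (χ₃ g) (χ₃ h)
    rw [← h₃] at e3
    have f1 := splitting_add α γ ε hrel (χ₁ g).val (χ₃ g).val (χ₁ h).val (χ₃ h).val
    have f2 := splitting_add_mul α γ ε hrel hαsum hγsum (χ₁ (g * h)).val (χ₃ (g * h)).val
      (carry (χ₁ g) (χ₁ h)) (carry (χ₃ g) (χ₃ h))
    have f3 : g • splitting α ε 0 0 (χ₁ h).val (χ₃ h).val =
        splitting α ε (χ₁ g).val (χ₃ g).val (χ₁ h).val (χ₃ h).val := by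
      simp only [splitting, smul_sub, smul_add, smul_comm g, smul_sum, hsmul, hα,
        ZMod.natCast_zmod_val, zero_add, add_zero, add_assoc]
    have hη₁' : ∑ l ∈ range p, ε 0 l = -(p • η₁) := by rw [hη₁, neg_neg]
    rw [← e1, ← e3, ← hη₃, hη₁'] at f2
    rw [f2] at f1
    simp only [map_sub, map_add, K.ι_mul, hι₁, hι₃, smul_sub, smul_add, smul_comm g, hβ, f3]
    generalize g • η₁ = a₁, g • η₃ = a₃, χ₁ (g * h) = x₁, χ₃ (g * h) = x₃,
      carry (χ₁ g) (χ₁ h) = c₁, carry (χ₃ g) (χ₃ h) = c₃,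
      (χ₁ g).val = i, (χ₁ h).val = i', (χ₃ g).val = j, (χ₃ h).val = j' at *
    generalize x₁.val = n, x₃.val = m at *
    have e1' : (n : ℤ) = i + i' - p * c₁ := by
      have : ((i + i' : ℕ) : ℤ) = (n + p * c₁ : ℕ) := by rw [e1]
      push_cast at this
      linarith
    have e3' : (m : ℤ) = j + j' - p * c₃ := by
      have : ((j + j' : ℕ) : ℤ) = (m + p * c₃ : ℕ) := by rw [e3]
      push_cast at this
      linarith
    linear_combination (norm := skip) (-1 : ℤ) • f1
    match_scalars
    all_goals push_cast
    all_goals try simp only [e1', e3']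
    all_goals ring1
  exact massey_of_symmetrized h₁ h₂ c₁ c₂ cD₂₁ cD₂₃ cE hD₂₁ hD₂₃ fun g h => by
    rw [hE]
    ring

/-- Triple Massey products vanish in the presence of Kummer theory. -/
theorem hasVanishingTripleMassey (K : KummerModule p G M) : HasVanishingTripleMassey G p := by
  rintro χ₁ χ₂ χ₃ h₁ h₂ h₃ c₁ c₂ c₃ ⟨D₁₂, D₂₃, cD₁₂, cD₂₃, hD₁₂, hD₂₃⟩
  rw [cts_iff] at *
  by_cases h0 : ∀ g, χ₁ g = 0
  · refine ⟨fun _ => 0, D₂₃, fun _ => 0, cts_iff.2 (.const 0), cts_iff.2 cD₂₃,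
      cts_iff.2 (.const 0), ?_, hD₂₃, ?_⟩ <;>
    · ext g h
      simp [cob, cup, h0]
  push Not at h0
  obtain ⟨g₁, hg₁⟩ := h0
  obtain ⟨n₁, hσ⟩ := h₁.exists_eq_one hg₁
  generalize g₁ ^ n₁ = σ at hσ
  have hD₂₁ : cob (fun g => -(χ₁ g * χ₂ g) - D₁₂ g) = cup χ₂ χ₁ := by
    ext g h
    have := congrFun₂ hD₁₂ g h
    simp only [cob, cup, h₁ g, h₂ g] at this ⊢
    linear_combination -this
  have cD₂₁ := (c₁.map₂ c₂ (fun a b => -(a * b))).map₂ cD₁₂ (· - ·)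
  by_cases hdep : ∀ g, χ₁ g = 0 → χ₃ g = 0
  · refine K.massey_of_dependent h₁ h₂ c₁ c₂ cD₂₁ hD₂₁ hσ (k := χ₃ σ) fun g => ?_
    have := hdep (g * (σ ^ (χ₁ g).val)⁻¹) (by rw [h₁, h₁.map_inv, h₁.map_pow, hσ]; simp)
    rw [h₃, h₃.map_inv, h₃.map_pow, ZMod.natCast_zmod_val] at this
    linear_combination this
  · push Not at hdep
    obtain ⟨g₃, hg₃, hg₃'⟩ := hdep
    obtain ⟨n₃, hτ⟩ := h₃.exists_eq_one hg₃'
    have hτ₁ : χ₁ (g₃ ^ n₃) = 0 := by rw [h₁.map_pow, hg₃, mul_zero]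
    generalize g₃ ^ n₃ = τ at hτ hτ₁
    refine K.massey_of_independent h₁ h₂ h₃ c₁ c₂ c₃ cD₂₁ hD₂₁ cD₂₃ hD₂₃
      (σ := σ * (τ ^ (χ₃ σ).val)⁻¹) (τ := τ) ?_ ?_ hτ₁ hτ
    · rw [h₁, h₁.map_inv, h₁.map_pow, hσ, hτ₁]
      simp
    · rw [h₃, h₃.map_inv, h₃.map_pow, hτ]
      simp

end KummerModule

section Corestriction

variable {p : ℕ} {G : Type*} [Group G] (H : Subgroup G)

/-- The `H`-component of the action of `g` on the chosen representative of the coset `c`. -/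
noncomputable def cosetFactor (g : G) (c : G ⧸ H) : H :=
  ⟨(g • c).out⁻¹ * (g * c.out), by
    rw [← QuotientGroup.eq, QuotientGroup.out_eq', ← smul_eq_mul, MulAction.Quotient.coe_smul_out]⟩

theorem coe_cosetFactor (g : G) (c : G ⧸ H) :
    (cosetFactor H g c : G) = (g • c).out⁻¹ * (g * c.out) := rfl

theorem out_mul_cosetFactor (g : G) (c : G ⧸ H) :
    (g • c).out * (cosetFactor H g c : G) = g * c.out := by
  rw [coe_cosetFactor, mul_inv_cancel_left]

theorem cosetFactor_mul (g g' : G) (c : G ⧸ H) :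
    cosetFactor H (g * g') c = cosetFactor H g (g' • c) * cosetFactor H g' c := by
  ext
  simp only [Subgroup.coe_mul, coe_cosetFactor, mul_smul]
  group

/-- A normalized form of `cor ∘ res = index` for 2-cocycles, coset by coset. -/
theorem cocycle_cosetFactor {f : G → G → ZMod p}
    (hf : ∀ a b c, f b c - f (a * b) c + f a (b * c) - f a b = 0) (g g' : G) (c : G ⧸ H) :
    f (cosetFactor H g (g' • c)) (cosetFactor H g' c) = f g g'
      + (f (g • g' • c).out (cosetFactor H g (g' • c)) - f g (g' • c).out)
      + (f (g' • c).out (cosetFactor H g' c) - f g' c.out)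
      - (f ((g * g') • c).out (cosetFactor H (g * g') c) - f (g * g') c.out) := by
  have h1 := hf (g • g' • c).out (cosetFactor H g (g' • c)) (cosetFactor H g' c)
  have h2 := hf g (g' • c).out (cosetFactor H g' c)
  have h3 := hf g g' c.out
  rw [out_mul_cosetFactor] at h1 h2
  rw [cosetFactor_mul, Subgroup.coe_mul, mul_smul]
  linear_combination h1 - h2 + h3

variable [TopologicalSpace G] [IsTopologicalGroup G]

theorem isLocallyConstant_smul_coset {H : Subgroup G} (hH : IsOpen (H : Set G)) (c : G ⧸ H) :
    IsLocallyConstant fun g : G => g • c := by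
  have := QuotientGroup.discreteTopology hH
  rw [IsLocallyConstant.iff_continuous]
  have : (fun g : G => g • c) = fun g => QuotientGroup.mk (g * c.out) := by
    ext g
    rw [← smul_eq_mul, MulAction.Quotient.coe_smul_out]
  rw [this]
  exact QuotientGroup.continuous_mk.comp (continuous_mul_const _)

theorem continuous_cosetFactor {H : Subgroup G} (hH : IsOpen (H : Set G)) (c : G ⧸ H) :
    Continuous fun g => cosetFactor H g c :=
  Continuous.subtype_mk ((((isLocallyConstant_smul_coset hH c).comp Quotient.out).continuous.inv).mul
    (continuous_mul_const _)) _

theorem isLocallyConstant_sum {X ι A : Type*} [TopologicalSpace X] [AddCommMonoid A] (s : Finset ι)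
    {f : ι → X → A} (hf : ∀ i ∈ s, IsLocallyConstant (f i)) :
    IsLocallyConstant fun x => ∑ i ∈ s, f i x := by
  classical
  induction s using Finset.induction_on with
  | empty => exact IsLocallyConstant.const 0
  | insert i s hi ih =>
    simp only [Finset.sum_insert hi]
    exact (hf i (by simp)).add (ih fun j hj => hf j (by simp [hj]))

/-- The vanishing of triple Massey products descends from open subgroups of index prime to `p`. -/
theorem hasVanishingTripleMassey_of_subgroup [Fact p.Prime] {H : Subgroup G}
    (hH : IsOpen (H : Set G)) [Finite (G ⧸ H)] (hidx : (H.index : ZMod p) ≠ 0)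
    (h : HasVanishingTripleMassey H p) : HasVanishingTripleMassey G p := by
  rintro χ₁ χ₂ χ₃ h₁ h₂ h₃ c₁ c₂ c₃ ⟨D₁₂, D₂₃, cD₁₂, cD₂₃, hD₁₂, hD₂₃⟩
  cases nonempty_fintype (G ⧸ H)
  rw [cts_iff] at c₁ c₂ c₃ cD₁₂ cD₂₃
  have cres : ∀ {f : G → ZMod p}, IsLocallyConstant f → Cts fun x : H => f x := fun hf =>
    cts_iff.2 (hf.comp_continuous continuous_subtype_val)
  obtain ⟨d₁₂, d₂₃, e, cd₁₂, cd₂₃, ce, hd₁₂, hd₂₃, he⟩ := h (fun x => χ₁ x) (fun x => χ₂ x)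
    (fun x => χ₃ x) (fun a b => h₁ a b) (fun a b => h₂ a b) (fun a b => h₃ a b) (cres c₁) (cres c₂)
    (cres c₃) ⟨fun x => D₁₂ x, fun x => D₂₃ x, cres cD₁₂, cres cD₂₃,
      funext₂ fun a b => congrFun₂ hD₁₂ a b, funext₂ fun a b => congrFun₂ hD₂₃ a b⟩
  rw [cts_iff] at cd₁₂ cd₂₃ ce
  obtain ⟨x, hx⟩ : ∃ x : H → ZMod p, x = fun a => d₁₂ a - D₁₂ a := ⟨_, rfl⟩
  obtain ⟨y, hy⟩ : ∃ y : H → ZMod p, y = fun a => d₂₃ a - D₂₃ a := ⟨_, rfl⟩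
  have cx : IsLocallyConstant x := by
    rw [hx]
    exact cd₁₂.sub (cD₁₂.comp_continuous continuous_subtype_val)
  have cy : IsLocallyConstant y := by
    rw [hy]
    exact cd₂₃.sub (cD₂₃.comp_continuous continuous_subtype_val)
  have hx' : ∀ a b, x (a * b) = x a + x b := by
    intro a b
    have a1 := congrFun₂ hd₁₂ a b
    have a2 := congrFun₂ hD₁₂ a b
    simp only [cob, cup, hx, Subgroup.coe_mul] at a1 a2 ⊢
    linear_combination a2 - a1
  have hy' : ∀ a b, y (a * b) = y a + y b := by
    intro a b
    have a1 := congrFun₂ hd₂₃ a b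
    have a2 := congrFun₂ hD₂₃ a b
    simp only [cob, cup, hy, Subgroup.coe_mul] at a1 a2 ⊢
    linear_combination a2 - a1
  obtain ⟨f, hf⟩ : ∃ f : G → G → ZMod p, f = fun a b => χ₁ a * D₂₃ b + D₁₂ a * χ₃ b := ⟨_, rfl⟩
  have hfcoc : ∀ a b c, f b c - f (a * b) c + f a (b * c) - f a b = 0 := by
    intro a b c
    have a1 := congrFun₂ hD₁₂ a b
    have a2 := congrFun₂ hD₂₃ b c
    simp only [cob, cup, hf, h₁ _ _, h₃ _ _] at a1 a2 ⊢
    linear_combination a1 * χ₃ c - a2 * χ₁ a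
  have he' : ∀ a b : H, e a + e b - e (a * b) = f a b + χ₁ a * y b + x a * χ₃ b := by
    intro a b
    have := congrFun₂ he a b
    simp only [cob, hf, hx, hy] at this ⊢
    linear_combination this
  have hfac : ∀ {χ : G → ZMod p}, IsHom1 χ → ∀ g (c : G ⧸ H),
      χ (cosetFactor H g c) = χ g + χ c.out - χ (g • c).out := by
    intro χ hχ g c
    rw [coe_cosetFactor, hχ, hχ, hχ.map_inv]
    ring
  have hreindex : ∀ (φ : G ⧸ H → ZMod p) (g : G), ∑ c, φ (g • c) = ∑ c, φ c := fun φ g =>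
    Equiv.sum_comp (MulAction.toPerm g) φ
  have ccor : ∀ {φ : H → ZMod p}, IsLocallyConstant φ → ∀ c,
      IsLocallyConstant fun g => φ (cosetFactor H g c) := fun hφ c =>
    hφ.comp_continuous (continuous_cosetFactor hH c)
  have cout : ∀ {φ : G → ZMod p} (c : G ⧸ H), IsLocallyConstant fun g : G => φ (g • c).out :=
    fun {φ} c => (isLocallyConstant_smul_coset hH c).comp fun c => φ c.out
  -- the cochain whose coboundary is the termwise difference
  obtain ⟨ψ, hψ⟩ : ∃ ψ : G → G ⧸ H → ZMod p, ψ = fun g c =>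
      e (cosetFactor H g c) - (f (g • c).out (cosetFactor H g c) - f g c.out)
      - χ₁ (g • c).out * y (cosetFactor H g c) + x (cosetFactor H g c) * χ₃ c.out := ⟨_, rfl⟩
  have hψ' : ∀ g g' c, ψ g (g' • c) + ψ g' c - ψ (g * g') c =
      f g g' + χ₁ g * y (cosetFactor H g' c) + x (cosetFactor H g (g' • c)) * χ₃ g' := by
    intro g g' c
    have a1 := he' (cosetFactor H g (g' • c)) (cosetFactor H g' c)
    have a2 := cocycle_cosetFactor H hfcoc g g' c
    rw [← cosetFactor_mul, hfac h₁, hfac h₃, a2] at a1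
    simp only [hψ, cosetFactor_mul, hx', hy', mul_smul] at a1 ⊢
    linear_combination a1
  have cψ : ∀ c, IsLocallyConstant fun g => ψ g c := by
    intro c
    simp only [hψ, hf]
    have b1 : IsLocallyConstant fun g => D₂₃ (cosetFactor H g c) :=
      ccor (cD₂₃.comp_continuous continuous_subtype_val) c
    have b2 : IsLocallyConstant fun g => χ₃ (cosetFactor H g c) :=
      ccor (c₃.comp_continuous continuous_subtype_val) c
    exact (((ccor ce c).sub ((((cout c).mul b1).add ((cout c).mul b2)).sub
      ((c₁.mul (.const _)).add (cD₁₂.mul (.const _))))).sub ((cout c).mul (ccor cy c))).add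
      ((ccor cx c).mul (.const _))
  have hcard : (∑ _c : G ⧸ H, (1 : ZMod p)) = H.index := by
    simp [Subgroup.index, Nat.card_eq_fintype_card]
  refine ⟨fun g => D₁₂ g + (H.index : ZMod p)⁻¹ * ∑ c, x (cosetFactor H g c),
    fun g => D₂₃ g + (H.index : ZMod p)⁻¹ * ∑ c, y (cosetFactor H g c),
    fun g => (H.index : ZMod p)⁻¹ * ∑ c, ψ g c,
    cts_iff.2 (cD₁₂.add ((isLocallyConstant_sum _ fun c _ => ccor cx c).comp _)),
    cts_iff.2 (cD₂₃.add ((isLocallyConstant_sum _ fun c _ => ccor cy c).comp _)),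
    cts_iff.2 ((isLocallyConstant_sum _ fun c _ => cψ c).comp _), ?_, ?_, ?_⟩
  · ext g g'
    have a1 := congrFun₂ hD₁₂ g g'
    have a2 := hreindex (fun c => x (cosetFactor H g c)) g'
    simp only [cob, cup, cosetFactor_mul, hx', Finset.sum_add_distrib] at a1 ⊢
    rw [a2]
    linear_combination a1
  · ext g g'
    have a1 := congrFun₂ hD₂₃ g g'
    have a2 := hreindex (fun c => y (cosetFactor H g c)) g'
    simp only [cob, cup, cosetFactor_mul, hy', Finset.sum_add_distrib] at a1 ⊢
    rw [a2]
    linear_combination a1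
  · ext g g'
    have a1 := Finset.sum_congr (rfl : (Finset.univ : Finset (G ⧸ H)) = _)
      fun c _ => hψ' g g' c
    have a2 := hreindex (fun c => x (cosetFactor H g c)) g'
    have a3 := hreindex (ψ g) g'
    have a4 : ∑ _c : G ⧸ H, f g g' = H.index * f g g' := by
      rw [← hcard, Finset.sum_mul]
      simp
    simp only [Finset.sum_add_distrib, Finset.sum_sub_distrib, ← Finset.mul_sum,
      ← Finset.sum_mul] at a1
    rw [a2, a3, a4] at a1
    have a5 : f g g' = χ₁ g * D₂₃ g' + D₁₂ g * χ₃ g' := by rw [hf]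
    simp only [cob]
    have a6 := mul_inv_cancel₀ hidx
    linear_combination (H.index : ZMod p)⁻¹ * a1 + a5 + f g g' * a6

end Corestriction

section Galois

variable {F L : Type*} [Field F] [Field L] [Algebra F L] [IsGalois F L]

theorem exists_sum_ne_zero {V : Subgroup (L ≃ₐ[F] L)} (hV : IsOpen (V : Set (L ≃ₐ[F] L)))
    [Fintype ((L ≃ₐ[F] L) ⧸ V)] (a : (L ≃ₐ[F] L) ⧸ V → L) (ha : a ≠ 0) :
    ∃ x : L, (∀ v ∈ V, v x = x) ∧ ∑ c, a c * c.out x ≠ 0 := by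
  let E := IntermediateField.fixedField V
  have hE : E.fixingSubgroup = V :=
    InfiniteGalois.fixingSubgroup_fixedField ⟨V, Subgroup.isClosed_of_isOpen V hV⟩
  let f : (L ≃ₐ[F] L) ⧸ V → (E →* L) := fun c =>
    ((c.out : L ≃ₐ[F] L) : L →* L).comp (E.val : E →* L)
  have hf : Function.Injective f := by
    intro c d hcd
    rw [← c.out_eq, ← d.out_eq]
    refine QuotientGroup.eq.2 (hE.le ?_)
    rw [IntermediateField.mem_fixingSubgroup_iff]
    intro x hx
    have h : c.out x = d.out x := DFunLike.congr_fun hcd (⟨x, hx⟩ : E)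
    rw [AlgEquiv.mul_apply, ← h]
    exact AlgEquiv.symm_apply_apply _ _
  have hli := (linearIndependent_monoidHom E L).comp f hf
  rw [Fintype.linearIndependent_iff] at hli
  by_contra! hcon
  refine ha (funext fun c => hli a ?_ c)
  funext x
  have hx : ∀ v ∈ V, v (x : L) = x := fun v hv => x.2 ⟨v, hv⟩
  simpa [f] using hcon x hx

theorem out_eq_of_invariant {G α : Type*} [Group G] {V : Subgroup G} (Φ : G → α)
    (hΦ : ∀ h, ∀ v ∈ V, Φ (h * v) = Φ h) (h : G) : Φ (QuotientGroup.mk (s := V) h).out = Φ h := by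
  obtain ⟨v, hv⟩ := QuotientGroup.mk_out_eq_mul V h
  rw [hv, hΦ h v v.2]

theorem sum_out_mul {G M : Type*} [Group G] [AddCommMonoid M] {V : Subgroup G} [Fintype (G ⧸ V)]
    (Φ : G → M) (hΦ : ∀ h, ∀ v ∈ V, Φ (h * v) = Φ h) (g : G) :
    ∑ c : G ⧸ V, Φ (g * c.out) = ∑ c : G ⧸ V, Φ c.out := by
  rw [← Equiv.sum_comp (MulAction.toPerm g) fun c : G ⧸ V => Φ c.out]
  refine Finset.sum_congr rfl fun c _ => ?_
  conv_rhs => rw [← c.out_eq]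
  exact (out_eq_of_invariant Φ hΦ (g * c.out)).symm

theorem exists_sum_eq_one {V : Subgroup (L ≃ₐ[F] L)} (hV : IsOpen (V : Set (L ≃ₐ[F] L)))
    [Fintype ((L ≃ₐ[F] L) ⧸ V)] :
    ∃ x : L, (∀ v ∈ V, v x = x) ∧ ∑ c : (L ≃ₐ[F] L) ⧸ V, c.out x = 1 := by
  obtain ⟨x, hx, hne⟩ := exists_sum_ne_zero hV (fun _ => 1) fun h =>
    one_ne_zero (congrFun h (QuotientGroup.mk 1))
  simp only [one_mul] at hne
  set t := ∑ c : (L ≃ₐ[F] L) ⧸ V, c.out x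
  have ht : ∀ g : L ≃ₐ[F] L, g t = t := fun g => by
    rw [map_sum]
    exact sum_out_mul (V := V) (fun h : L ≃ₐ[F] L => h x) (fun h v hv => by simp [hx v hv]) g
  refine ⟨t⁻¹ * x, fun v hv => by simp [ht, hx v hv], ?_⟩
  simp only [map_mul, map_inv₀, ht, ← Finset.mul_sum]
  exact inv_mul_cancel₀ hne

theorem finite_quotient_of_isOpen {V : Subgroup (L ≃ₐ[F] L)}
    (hV : IsOpen (V : Set (L ≃ₐ[F] L))) : Finite ((L ≃ₐ[F] L) ⧸ V) :=
  Subgroup.quotient_finite_of_isOpen V hV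

theorem isLocallyConstant_apply (x : L) : IsLocallyConstant fun g : L ≃ₐ[F] L => g x := by
  rw [IsLocallyConstant.iff_exists_open]
  intro g
  refine ⟨(fun h => g⁻¹ * h) ⁻¹' MulAction.stabilizer (L ≃ₐ[F] L) x,
    (stabilizer_isOpen_of_isIntegral x).preimage (continuous_const_mul _), ?_, ?_⟩
  · simp
  · intro h hh
    have h1 : g⁻¹ (h x) = x := hh
    have h2 := congrArg g h1
    rwa [← AlgEquiv.mul_apply, mul_inv_cancel, AlgEquiv.one_apply] at h2

theorem hilbert90_units {U : Subgroup (L ≃ₐ[F] L)} (hU : IsOpen (U : Set (L ≃ₐ[F] L)))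
    (w : (L ≃ₐ[F] L) → L) (hw : IsLocallyConstant w) (hw0 : ∀ g ∈ U, w g ≠ 0)
    (hc : ∀ g ∈ U, ∀ h ∈ U, w (g * h) = w g * g (w h)) :
    ∃ y : L, y ≠ 0 ∧ ∀ g ∈ U, w g * y = g y := by
  classical
  have h1 : w 1 = 1 := by
    have := hc 1 U.one_mem 1 U.one_mem
    simpa [hw0 1 U.one_mem] using this
  let V : Subgroup (L ≃ₐ[F] L) :=
    { carrier := {g | g ∈ U ∧ w g = 1}
      one_mem' := ⟨U.one_mem, h1⟩
      mul_mem' := fun {g h} hg hh => ⟨U.mul_mem hg.1 hh.1, by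
        rw [hc g hg.1 h hh.1, hg.2, hh.2, map_one, mul_one]⟩
      inv_mem' := fun {g} hg => ⟨U.inv_mem hg.1, by
        have h := hc g⁻¹ (U.inv_mem hg.1) g hg.1
        rw [inv_mul_cancel, h1, hg.2, map_one, mul_one] at h
        exact h.symm⟩ }
  have hV : IsOpen (V : Set (L ≃ₐ[F] L)) := hU.inter (hw.isOpen_fiber 1)
  have := finite_quotient_of_isOpen hV
  let _ := Fintype.ofFinite ((L ≃ₐ[F] L) ⧸ V)
  let φ : (L ≃ₐ[F] L) → L := fun h => if h ∈ U then w h else 0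
  have hφ : ∀ h, ∀ v ∈ V, φ (h * v) = φ h := by
    intro h v hv
    by_cases hh : h ∈ U
    · simp [φ, hh, U.mul_mem hh hv.1, hc h hh v hv.1, hv.2]
    · simp [φ, hh, U.mul_mem_cancel_right hv.1]
  obtain ⟨x, hx, hne⟩ := exists_sum_ne_zero hV (fun c => φ c.out) fun h => by
    have := congrFun h (QuotientGroup.mk 1)
    rw [out_eq_of_invariant φ hφ] at this
    simp [φ, U.one_mem, h1] at this
  set z := ∑ c : (L ≃ₐ[F] L) ⧸ V, φ c.out * c.out x
  have hz : ∀ g ∈ U, w g * g z = z := by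
    intro g hg
    rw [map_sum, Finset.mul_sum]
    refine Eq.trans (Finset.sum_congr rfl fun c _ => ?_)
      (sum_out_mul (V := V) (fun h : L ≃ₐ[F] L => φ h * h x)
        (fun h v hv => by rw [hφ h v hv, AlgEquiv.mul_apply, hx v hv]) g)
    by_cases hh : c.out ∈ U
    · simp [φ, hh, U.mul_mem hg hh, hc g hg _ hh, mul_assoc]
    · simp [φ, hh, U.mul_mem_cancel_left hg]
  refine ⟨z⁻¹, inv_ne_zero hne, fun g hg => ?_⟩
  have hgz : g z ≠ 0 := by simpa using hne
  rw [map_inv₀, ← div_eq_mul_inv, div_eq_iff hne, eq_comm, inv_mul_eq_iff_eq_mul₀ hgz, mul_comm,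
    hz g hg]

theorem hilbert90_add (w : (L ≃ₐ[F] L) → L) (hw : IsLocallyConstant w)
    (hc : ∀ g h, w (g * h) = w g + g (w h)) : ∃ y : L, ∀ g, w g = g y - y := by
  have h1 : w 1 = 0 := by simpa using hc 1 1
  let V : Subgroup (L ≃ₐ[F] L) :=
    { carrier := {g | w g = 0}
      one_mem' := h1
      mul_mem' := fun {g h} (hg : w g = 0) (hh : w h = 0) => by
        simp [hc, hg, hh]
      inv_mem' := fun {g} (hg : w g = 0) => by
        have h := hc g⁻¹ g
        rw [inv_mul_cancel, h1, hg, map_zero, add_zero] at h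
        exact h.symm }
  have hV : IsOpen (V : Set (L ≃ₐ[F] L)) := hw.isOpen_fiber 0
  have := finite_quotient_of_isOpen hV
  let _ := Fintype.ofFinite ((L ≃ₐ[F] L) ⧸ V)
  obtain ⟨x, hx, hx1⟩ := exists_sum_eq_one hV
  have hwV : ∀ h, ∀ v ∈ V, w (h * v) = w h := fun h v (hv : w v = 0) => by
    simp [hc, hv]
  refine ⟨-∑ c : (L ≃ₐ[F] L) ⧸ V, w c.out * c.out x, fun g => ?_⟩
  have hinv : ∀ h, ∀ v ∈ V, (h * v) x = h x := fun h v hv => by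
    rw [AlgEquiv.mul_apply, hx v hv]
  have key := sum_out_mul (V := V) (fun h : L ≃ₐ[F] L => w h * h x)
    (fun h v hv => by rw [hwV h v hv, hinv h v hv]) g
  have key1 := sum_out_mul (V := V) (fun h : L ≃ₐ[F] L => h x) hinv g
  simp only [hc, add_mul, Finset.sum_add_distrib, ← Finset.mul_sum, key1, hx1] at key
  rw [map_neg, map_sum, ← key]
  simp

end Galois

section CharP

variable {F L : Type*} [Field F] [Field L] [Algebra F L] [IsSepClosure F L]

/-- In characteristic `p`, the group `H²(G_F, ZMod p)` vanishes. The invariance hypothesis expresses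
that the cocycle `X` is continuous. -/
theorem exists_cob_eq_of_char {p : ℕ} [Fact p.Prime] (hp : (p : L) = 0)
    (X : (L ≃ₐ[F] L) → (L ≃ₐ[F] L) → ZMod p)
    (hX : ∀ g h k, X g h + X (g * h) k = X h k + X g (h * k))
    {V : Subgroup (L ≃ₐ[F] L)} (hV : IsOpen (V : Set (L ≃ₐ[F] L)))
    (hXV : ∀ g h, ∀ v ∈ V, X g (h * v) = X g h)
    (hXl : ∀ h, IsLocallyConstant fun g => X g h) :
    ∃ E : (L ≃ₐ[F] L) → ZMod p, Cts E ∧ cob E = X := by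
  have : IsGalois F L := IsSepClosure.isGalois
  have : IsSepClosed L := IsSepClosure.sep_closed F
  have : CharP L p := (CharP.charP_iff_prime_eq_zero Fact.out).2 hp
  have : ExpChar L p := .prime Fact.out
  let j : ZMod p →+* L := ZMod.castHom dvd_rfl L
  have hj : ∀ (g : L ≃ₐ[F] L) a, g (j a) = j a := fun g a => by
    exact RingHom.congr_fun (Subsingleton.elim ((g : L →+* L).comp j) j) a
  have hjp : ∀ a, j a ^ p = j a := fun a => by rw [← map_pow, ZMod.pow_card]
  have := finite_quotient_of_isOpen hV
  let _ := Fintype.ofFinite ((L ≃ₐ[F] L) ⧸ V)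
  obtain ⟨x, hx, hx1⟩ := exists_sum_eq_one hV
  let u : (L ≃ₐ[F] L) → L := fun g => ∑ c : (L ≃ₐ[F] L) ⧸ V, j (X g c.out) * (g * c.out) x
  have hinv : ∀ h, ∀ v ∈ V, (h * v) x = h x := fun h v hv => by
    rw [AlgEquiv.mul_apply, hx v hv]
  have hu : ∀ g h, u g + g (u h) - u (g * h) = j (X g h) := by
    intro g h
    have e1 : u g = ∑ c : (L ≃ₐ[F] L) ⧸ V, j (X g (h * c.out)) * (g * (h * c.out)) x :=
      (sum_out_mul (V := V) (fun k : L ≃ₐ[F] L => j (X g k) * (g * k) x)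
        (fun k v hv => by rw [hXV g k v hv, ← mul_assoc, hinv _ v hv]) h).symm
    have e2 : j (X g h) = ∑ c : (L ≃ₐ[F] L) ⧸ V, j (X g h) * (g * (h * c.out)) x := by
      rw [← Finset.mul_sum]
      have := sum_out_mul (V := V) (fun h : L ≃ₐ[F] L => h x) hinv (g * h)
      simp only [mul_assoc] at this
      rw [this, hx1, mul_one]
    rw [e1, e2, map_sum, ← Finset.sum_add_distrib, ← Finset.sum_sub_distrib]
    refine Finset.sum_congr rfl fun c _ => ?_
    have h3 := congrArg j (hX g h c.out)
    simp only [map_add] at h3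
    simp only [map_mul, hj, AlgEquiv.mul_apply]
    linear_combination (-(g (h (c.out x)))) * h3
  have hul : IsLocallyConstant u := by
    refine isLocallyConstant_sum _ fun c _ => ?_
    refine ((hXl c.out).comp j).mul ?_
    exact isLocallyConstant_apply (c.out x)
  obtain ⟨y, hy⟩ := hilbert90_add (fun g => u g ^ p - u g) (hul.comp fun a => a ^ p - a)
    (fun g h => by
      have h1 : u (g * h) = u g + g (u h) - j (X g h) := by rw [← hu g h]; ring
      simp only [h1, sub_pow_expChar, add_pow_expChar, hjp, map_sub, map_pow]
      ring)
  obtain ⟨z, hz⟩ := IsSepClosed.exists_root_C_mul_X_pow_add_C_mul_X_add_C (1 : L) (-1) (-y) hp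
    (Fact.out : p.Prime).two_le (by simp)
  have hzy : y = z ^ p - z := by linear_combination -hz
  have hE : ∀ g, ∃ a, j a = u g - (g z - z) := by
    intro g
    have h1 : u g - (g z - z) ∈ (⊥ : Subfield L) := by
      refine (Subfield.mem_bot_iff_pow_eq_self (F := L) (p := p)).2 ?_
      have h2 := hy g
      simp only [hzy, map_sub, map_pow] at h2
      rw [sub_pow_expChar, sub_pow_expChar]
      linear_combination h2
    have h2 : (⊥ : Subfield L) ≤ j.fieldRange := bot_le
    exact h2 h1
  choose E hE using hE
  have hinj : Function.Injective j := j.injective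
  refine ⟨E, cts_iff.2 ?_, ?_⟩
  · refine IsLocallyConstant.desc E j ?_ hinj
    have : j ∘ E = fun g => u g - (g z - z) := funext hE
    rw [this]
    exact hul.sub ((isLocallyConstant_apply z).sub (IsLocallyConstant.const z))
  · funext g h
    apply hinj
    simp only [cob, map_sub, map_add, hE, ← hu g h]
    have h1 := congrArg g (hE h)
    rw [hj, hE, map_sub, map_sub] at h1
    simp only [AlgEquiv.mul_apply]
    linear_combination h1

theorem hasVanishingTripleMassey_of_char {p : ℕ} [Fact p.Prime] (hp : (p : L) = 0) :
    HasVanishingTripleMassey (L ≃ₐ[F] L) p := by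
  rintro χ₁ χ₂ χ₃ h₁ h₂ h₃ c₁ c₂ c₃ ⟨D₁₂, D₂₃, hc₁₂, hc₂₃, hD₁₂, hD₂₃⟩
  have e₁₂ : ∀ g h, D₁₂ (g * h) = D₁₂ g + D₁₂ h - χ₁ g * χ₂ h := fun g h => by
    have := congrFun (congrFun hD₁₂ g) h
    simp only [cob, cup] at this
    linear_combination -this
  have e₂₃ : ∀ g h, D₂₃ (g * h) = D₂₃ g + D₂₃ h - χ₂ g * χ₃ h := fun g h => by
    have := congrFun (congrFun hD₂₃ g) h
    simp only [cob, cup] at this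
    linear_combination -this
  have a₁ : ∀ g h, χ₁ (g * h) = χ₁ g + χ₁ h := h₁
  have a₃ : ∀ g h, χ₃ (g * h) = χ₃ g + χ₃ h := h₃
  have hone : χ₃ 1 = 0 := by simpa using h₃ 1 1
  have hone' : D₂₃ 1 = 0 := by simpa [hone] using e₂₃ 1 1
  let V : Subgroup (L ≃ₐ[F] L) :=
    { carrier := {v | χ₃ v = 0 ∧ D₂₃ v = 0}
      one_mem' := ⟨hone, hone'⟩
      mul_mem' := fun {g h} hg hh => ⟨by rw [h₃, hg.1, hh.1, add_zero], by
        rw [e₂₃, hg.2, hh.1, hh.2, mul_zero, add_zero, sub_zero]⟩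
      inv_mem' := fun {g} hg => by
        have a1 := h₃ g⁻¹ g
        have a2 := e₂₃ g⁻¹ g
        rw [inv_mul_cancel, hone, hg.1, add_zero] at a1
        rw [inv_mul_cancel, hone', hg.1, hg.2, mul_zero, add_zero, sub_zero] at a2
        exact ⟨a1.symm, a2.symm⟩ }
  have hV : IsOpen (V : Set (L ≃ₐ[F] L)) := (c₃ 0).inter (hc₂₃ 0)
  obtain ⟨E, hE, hcob⟩ := exists_cob_eq_of_char (F := F) hp
    (fun σ τ => χ₁ σ * D₂₃ τ + D₁₂ σ * χ₃ τ) (fun g h k => by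
      simp only [a₁, a₃, e₁₂, e₂₃]
      ring) hV (fun g h v hv => by
      simp only [a₃, e₂₃, hv.1, hv.2]
      ring) (fun h => (((cts_iff.1 c₁).mul (IsLocallyConstant.const _)).add
        ((cts_iff.1 hc₁₂).mul (IsLocallyConstant.const _))))
  exact ⟨D₁₂, D₂₃, E, hc₁₂, hc₂₃, hE, hD₁₂, hD₂₃, hcob⟩

end CharP

section Kummer

variable {F L : Type*} [Field F] [Field L] [Algebra F L]

/-- The action of a group of field automorphisms on the multiplicative group, written additively. -/
instance additiveUnitsAction (H : Subgroup (L ≃ₐ[F] L)) : DistribMulAction H (Additive Lˣ) where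
  smul g m := Additive.ofMul (Units.map ((g : L ≃ₐ[F] L) : L →* L) m.toMul)
  one_smul _ := Additive.toMul.injective (Units.ext rfl)
  mul_smul _ _ _ := Additive.toMul.injective (Units.ext rfl)
  smul_zero g := Additive.toMul.injective (map_one (Units.map ((g : L ≃ₐ[F] L) : L →* L)))
  smul_add g _ _ := Additive.toMul.injective (map_mul (Units.map ((g : L ≃ₐ[F] L) : L →* L)) _ _)

theorem coe_toMul_smul {H : Subgroup (L ≃ₐ[F] L)} (g : H) (m : Additive Lˣ) :
    ((g • m).toMul : L) = (g : L ≃ₐ[F] L) (m.toMul : L) := rfl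

theorem additiveUnits_ext {m n : Additive Lˣ} (h : (m.toMul : L) = (n.toMul : L)) : m = n :=
  Additive.toMul.injective (Units.ext h)

variable [IsSepClosure F L]

/-- Kummer theory over a field containing a primitive `p`-th root of unity. -/
theorem nonempty_kummerModule {p : ℕ} [Fact p.Prime] (hp : (p : L) ≠ 0) {ζ : L}
    (hζ : IsPrimitiveRoot ζ p) :
    Nonempty (KummerModule p (MulAction.stabilizer (L ≃ₐ[F] L) ζ) (Additive Lˣ)) := by
  have : IsGalois F L := IsSepClosure.isGalois
  have : IsSepClosed L := IsSepClosure.sep_closed F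
  have : NeZero (p : L) := ⟨hp⟩
  have hp0 : p ≠ 0 := (Fact.out : p.Prime).ne_zero
  set H := MulAction.stabilizer (L ≃ₐ[F] L) ζ with hH
  have hHo : IsOpen (H : Set (L ≃ₐ[F] L)) := stabilizer_isOpen_of_isIntegral ζ
  obtain ⟨ξ, hξ⟩ : ∃ ξ : Lˣ, (ξ : L) = ζ := ⟨Units.mk0 ζ (hζ.ne_zero hp0), rfl⟩
  have hξp : IsPrimitiveRoot ξ p := by
    rwa [← IsPrimitiveRoot.coe_units_iff, hξ]
  let f : ℤ →+ Additive Lˣ := zmultiplesHom _ (Additive.ofMul ξ)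
  have hf : f p = 0 := by
    simp [f, ← ofMul_pow, hξp.pow_eq_one]
  let ι : ZMod p →+ Additive Lˣ := ZMod.lift p ⟨f, hf⟩
  have hι : ∀ n : ℕ, ι n = Additive.ofMul (ξ ^ n) := fun n => by
    have := ZMod.lift_coe p ⟨f, hf⟩ n
    simpa [ι, f] using this
  refine ⟨⟨ι, ?_, ?_, ?_, ?_, ?_, ?_⟩⟩
  · rw [injective_iff_map_eq_zero]
    intro a ha
    obtain ⟨n, rfl⟩ : ∃ n : ℕ, (n : ZMod p) = a := ⟨a.val, by simp⟩
    rw [hι, ofMul_eq_zero, hξp.pow_eq_one_iff_dvd] at ha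
    exact (ZMod.natCast_eq_zero_iff _ _).2 ha
  · intro m hm
    have h1 : (m.toMul : Lˣ) ^ p = 1 := hm
    obtain ⟨i, -, hi⟩ := (IsPrimitiveRoot.coe_units_iff.2 hξp).eq_pow_of_pow_eq_one
      (by rw [← Units.val_pow_eq_pow_val, h1, Units.val_one])
    refine ⟨i, additiveUnits_ext ?_⟩
    rw [hι, ← hi]
    rfl
  · intro g a
    obtain ⟨n, rfl⟩ : ∃ n : ℕ, (n : ZMod p) = a := ⟨a.val, by simp⟩
    apply additiveUnits_ext
    have h1 : (g : L ≃ₐ[F] L) ζ = ζ := g.2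
    rw [coe_toMul_smul, hι]
    simp [hξ, h1]
  · intro m
    refine IsLocallyConstant.desc _ (fun n : Additive Lˣ => (n.toMul : L)) ?_
      fun _ _ => additiveUnits_ext
    exact (isLocallyConstant_apply (m.toMul : L)).comp_continuous continuous_subtype_val
  · intro m
    obtain ⟨z, hz⟩ := IsSepClosed.exists_pow_nat_eq (m.toMul : L) p
    have hz0 : z ≠ 0 := by
      rintro rfl
      rw [zero_pow hp0] at hz
      exact m.toMul.ne_zero hz.symm
    exact ⟨Additive.ofMul (Units.mk0 z hz0), additiveUnits_ext (by simpa using hz)⟩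
  · intro U hU w hw hc
    classical
    let w' : (L ≃ₐ[F] L) → L := fun g => if h : g ∈ H then ((w ⟨g, h⟩).toMul : L) else 1
    have hw'H : ∀ g : H, w' g = ((w g).toMul : L) := fun g => by simp [w']
    have hUo : IsOpen ((U.map H.subtype : Subgroup (L ≃ₐ[F] L)) : Set (L ≃ₐ[F] L)) := by
      rw [Subgroup.coe_map]
      exact hHo.isOpenMap_subtype_val _ hU
    have hw' : IsLocallyConstant w' := by
      refine (IsLocallyConstant.iff_exists_open _).2 fun g => ?_
      by_cases hg : g ∈ H
      · refine ⟨_, hHo.isOpenMap_subtype_val _ (hw.isOpen_fiber (w ⟨g, hg⟩)),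
          ⟨⟨g, hg⟩, rfl, rfl⟩, ?_⟩
        rintro _ ⟨h, hh : w h = w ⟨g, hg⟩, rfl⟩
        rw [hw'H h, hh]
        exact (hw'H ⟨g, hg⟩).symm
      · refine ⟨_, (Subgroup.isClosed_of_isOpen H hHo).isOpen_compl, hg, fun h hh => ?_⟩
        have hh' : h ∉ H := hh
        simp [w', hg, hh']
    suffices h90 : ∃ y : L, y ≠ 0 ∧ ∀ g ∈ U.map H.subtype, w' g * y = g y by
      obtain ⟨y, hy0, hy⟩ := h90
      refine ⟨Additive.ofMul (Units.mk0 y hy0), fun g hg => ?_⟩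
      have h1 := hy g ⟨g, hg, rfl⟩
      rw [eq_sub_iff_add_eq]
      apply additiveUnits_ext
      rw [coe_toMul_smul]
      simpa [hw'H] using h1
    refine hilbert90_units hUo w' hw' ?_ ?_
    · rintro _ ⟨g, hg, rfl⟩
      simp [hw'H]
    · rintro _ ⟨g, hg, rfl⟩ _ ⟨h, hh, rfl⟩
      have h1 := congrArg (fun n : Additive Lˣ => (n.toMul : L)) (hc g hg h hh)
      simp only [Subgroup.coe_subtype, ← Subgroup.coe_mul, hw'H, h1]
      rfl

theorem hasVanishingTripleMassey_of_not_char {p : ℕ} [Fact p.Prime] (hp : (p : L) ≠ 0) :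
    HasVanishingTripleMassey (L ≃ₐ[F] L) p := by
  have : IsGalois F L := IsSepClosure.isGalois
  have : IsSepClosed L := IsSepClosure.sep_closed F
  have : NeZero (p : L) := ⟨hp⟩
  have hp' : p.Prime := Fact.out
  have : NeZero p := ⟨hp'.ne_zero⟩
  obtain ⟨ζ, hζ⟩ := HasEnoughRootsOfUnity.exists_primitiveRoot L p
  have hHo : IsOpen (MulAction.stabilizer (L ≃ₐ[F] L) ζ : Set (L ≃ₐ[F] L)) :=
    stabilizer_isOpen_of_isIntegral ζ
  have hfin := finite_quotient_of_isOpen hHo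
  refine hasVanishingTripleMassey_of_subgroup hHo ?_
    (nonempty_kummerModule hp hζ).some.hasVanishingTripleMassey
  rw [Ne, ZMod.natCast_eq_zero_iff]
  refine Nat.not_dvd_of_pos_of_lt (Nat.pos_of_ne_zero Subgroup.index_ne_zero_of_finite) ?_
  have hsub : MulAction.orbit (L ≃ₐ[F] L) ζ ⊆ (primitiveRoots p L : Set L) := by
    rintro _ ⟨g, rfl⟩
    exact (mem_primitiveRoots hp'.pos).2 (hζ.map_of_injective (f := g) g.injective)
  calc _ = (MulAction.orbit (L ≃ₐ[F] L) ζ).ncard := MulAction.index_stabilizer _ _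
    _ ≤ (primitiveRoots p L : Set L).ncard := Set.ncard_le_ncard hsub (Finset.finite_toSet _)
    _ = p - 1 := by rw [Set.ncard_coe_finset, hζ.card_primitiveRoots, Nat.totient_prime hp']
    _ < p := Nat.sub_lt hp'.pos one_pos

end Kummer

end TripleMassey

/-- **Triple Massey products vanish over all fields.** For every field `F` and every
prime `p`, the absolute Galois group `G_F = Gal(F_s/F)` (with the Krull topology, `F_s`
a separable closure of `F`) has the vanishing triple Massey product property
with respect to `𝔽_p`. -/
theorem triple_massey_vanish_over_all_fields (p : ℕ) (hp : p.Prime)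
    (F Fs : Type*) [Field F] [Field Fs] [Algebra F Fs] [IsSepClosure F Fs] :
    HasVanishingTripleMassey (Fs ≃ₐ[F] Fs) p := by
  have := Fact.mk hp
  by_cases h : (p : Fs) = 0
  · exact TripleMassey.hasVanishingTripleMassey_of_char h
  · exact TripleMassey.hasVanishingTripleMassey_of_not_char h
end

section
/- Let p be a prime and F a field containing a primitive p-th root of unity, and let a, b, c ∈ F^×. If the triple Massey product ⟨χ_a, χ_b, χ_c⟩ is defined (i.e. both χ_a ∪ χ_b and χ_b ∪ χ_c are coboundaries of continuous 1-cochains), then it contains 0. -/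
/-- `χ` is the Kummer character attached to the `p`-th root `r` (of some element of `F`),
with respect to the primitive `p`-th root of unity `ξ` of `F`:
`σ r = ξ^(χ σ) * r` for all `σ` in the absolute Galois group. -/
def IsKummerChar {F Fs : Type*} [Field F] [Field Fs] [Algebra F Fs]
    {p : ℕ} (ξ : F) (r : Fs) (χ : (Fs ≃ₐ[F] Fs) → ZMod p) : Prop :=
  ∀ σ : Fs ≃ₐ[F] Fs, σ r = algebraMap F Fs ξ ^ (χ σ).val * r

/-! ### Modules satisfying Hilbert 90 and Kummer theory -/

/-- A topological group `G` acting on an abelian group `M` (such as the multiplicative group of a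
separable closure) which is `p`-divisible, satisfies Hilbert 90 for all subgroups, and whose
`p`-torsion is a copy of `ZMod p` with trivial action. -/
structure KummerModule (p : ℕ) (G M : Type*) [Group G] [TopologicalSpace G] [AddCommGroup M]
    [DistribMulAction G M] where
  /-- The identification of `ZMod p` with the `p`-torsion of `M`. -/
  ι : ZMod p →+ M
  ι_injective : Function.Injective ι
  smul_ι : ∀ (g : G) x, g • ι x = ι x
  exists_ι_eq : ∀ m : M, p • m = 0 → ∃ x, ι x = m
  exists_nsmul_eq : ∀ m : M, ∃ m', p • m' = m
  isLocallyConstant_smul : ∀ m : M, IsLocallyConstant fun g : G => g • m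
  hilbert90 : ∀ (H : Subgroup G) (w : G → M), IsLocallyConstant w →
    (∀ g ∈ H, ∀ h ∈ H, w (g * h) = w g + g • w h) → ∃ y, ∀ g ∈ H, w g = g • y - y

/-- `χ` is a continuous character of `G` with values in `ZMod p`. -/
structure IsCtsChar {p : ℕ} {G : Type*} [Group G] [TopologicalSpace G] (χ : G → ZMod p) :
    Prop where
  isLocallyConstant : IsLocallyConstant χ
  map_mul : ∀ g h, χ (g * h) = χ g + χ h

theorem Function.Periodic.val_add_zmod {p : ℕ} {α : Type*} {Q : ℕ → α}
    (hQ : Function.Periodic Q p) (x y : ZMod p) [NeZero p] :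
    Q (x + y).val = Q (x.val + y.val) := by
  rw [ZMod.val_add, hQ.map_mod_nat]

theorem Function.Periodic.sum_range_add {p : ℕ} {M : Type*} [AddCommGroup M] {Q : ℕ → M}
    (hQ : Function.Periodic Q p) (l : ℕ) :
    ∑ i ∈ Finset.range p, Q (l + i) = ∑ i ∈ Finset.range p, Q i := by
  induction l with
  | zero => simp
  | succ l ih =>
    have h1 := Finset.sum_range_succ' (fun i => Q (l + i)) p
    have h2 := Finset.sum_range_succ (fun i => Q (l + i)) p
    have h3 : Q (l + p) = Q (l + 0) := hQ l
    rw [h2, h3] at h1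
    rw [← ih, add_right_cancel h1]
    exact Finset.sum_congr rfl fun i _ => by congr 1; omega

namespace IsCtsChar

variable {p : ℕ} {G : Type*} [Group G] [TopologicalSpace G] {χ ψ : G → ZMod p}

theorem map_one (hχ : IsCtsChar χ) : χ 1 = 0 := by
  simpa using hχ.map_mul 1 1

theorem map_inv (hχ : IsCtsChar χ) (g : G) : χ g⁻¹ = -χ g := by
  have := hχ.map_mul g⁻¹ g
  rw [inv_mul_cancel, hχ.map_one] at this
  linear_combination -this

theorem map_pow (hχ : IsCtsChar χ) (g : G) (k : ℕ) : χ (g ^ k) = k * χ g := by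
  induction k with
  | zero => simp [hχ.map_one]
  | succ k ih => rw [pow_succ, hχ.map_mul, ih]; push_cast; ring

theorem map_pow_p (hχ : IsCtsChar χ) (g : G) : χ (g ^ p) = 0 := by
  simp [hχ.map_pow]

theorem sub (hχ : IsCtsChar χ) (hψ : IsCtsChar ψ) : IsCtsChar fun g => χ g - ψ g where
  isLocallyConstant := hχ.isLocallyConstant.comp₂ hψ.isLocallyConstant (· - ·)
  map_mul g h := by rw [hχ.map_mul, hψ.map_mul]; ring

/-- The kernel of a character. -/
def ker (hχ : IsCtsChar χ) : Subgroup G where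
  carrier := {g | χ g = 0}
  mul_mem' {g h} hg hh := by simp_all [hχ.map_mul]
  one_mem' := hχ.map_one
  inv_mem' {g} hg := by simp_all [hχ.map_inv]

theorem mem_ker (hχ : IsCtsChar χ) {g : G} : g ∈ hχ.ker ↔ χ g = 0 := Iff.rfl

/-- Every element is a power of `σ` times an element of the kernel, if `χ σ = 1`. -/
theorem map_inv_pow_mul (hχ : IsCtsChar χ) [NeZero p] {σ : G} (hσ : χ σ = 1) (g : G) :
    χ ((σ ^ (χ g).val)⁻¹ * g) = 0 := by
  rw [hχ.map_mul, hχ.map_inv, hχ.map_pow, hσ, ZMod.natCast_zmod_val]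
  ring

theorem exists_eq_one [Fact p.Prime] (hχ : IsCtsChar χ) {g : G} (hg : χ g ≠ 0) :
    ∃ k : ℕ, χ (g ^ k) = 1 :=
  ⟨(χ g)⁻¹.val, by rw [hχ.map_pow, ZMod.natCast_zmod_val, inv_mul_cancel₀ hg]⟩

end IsCtsChar

theorem IsLocallyConstant.apply₂ {X Y Z : Type*} [TopologicalSpace X] {f : X → Y}
    {F : Y → X → Z} (hf : IsLocallyConstant f) (hF : ∀ y, IsLocallyConstant (F y)) :
    IsLocallyConstant fun x => F (f x) x := by
  rw [IsLocallyConstant.iff_eventually_eq]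
  intro x
  filter_upwards [hf.eventually_eq x, (hF (f x)).eventually_eq x] with y h1 h2
  rw [h1, h2]

namespace KummerModule

variable {p : ℕ} {G M : Type*} [Group G] [TopologicalSpace G]
  [AddCommGroup M] [DistribMulAction G M]

theorem nsmul_ι (K : KummerModule p G M) (x : ZMod p) : p • K.ι x = 0 := by
  rw [← map_nsmul]; simp

/-- A character of a subgroup is the Kummer character of some element. -/
theorem exists_root (K : KummerModule p G M) (H : Subgroup G) {κ : G → ZMod p}
    (hκ : IsLocallyConstant κ) (hmul : ∀ g ∈ H, ∀ h ∈ H, κ (g * h) = κ g + κ h) :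
    ∃ y : M, ∀ g ∈ H, g • y = y + K.ι (κ g) := by
  obtain ⟨y, hy⟩ := K.hilbert90 H (fun g => K.ι (κ g)) (hκ.comp K.ι) fun g hg h hh => by
    rw [K.smul_ι, hmul g hg h hh, map_add]
  exact ⟨y, fun g hg => by rw [hy g hg]; abel⟩

/-- The Kummer character of a `p`-th root of an invariant element. -/
theorem exists_char (K : KummerModule p G M) {r : M} (hr : ∀ g : G, g • p • r = p • r) :
    ∃ ψ : G → ZMod p, IsCtsChar ψ ∧ ∀ g : G, g • r = r + K.ι (ψ g) := by
  have hex : ∀ g : G, ∃ x, K.ι x = g • r - r := fun g => K.exists_ι_eq _ <| by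
    rw [nsmul_sub, ← smul_comm, hr, sub_self]
  have key : ∀ g : G, K.ι (Function.invFun K.ι (g • r - r)) = g • r - r :=
    fun g => Function.invFun_eq (hex g)
  refine ⟨fun g => Function.invFun K.ι (g • r - r),
    ⟨(K.isLocallyConstant_smul r).comp fun m => Function.invFun K.ι (m - r), fun g h => ?_⟩,
    fun g => by rw [key]; abel⟩
  apply K.ι_injective
  have : g • (h • r - r) = h • r - r := by rw [← key h, K.smul_ι]
  rw [map_add, key, key, key, mul_smul]
  rw [smul_sub] at this
  rw [← this]
  abel

/-- A cocycle with values in `ZMod p` which becomes a coboundary in `M` is a coboundary. -/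
theorem exists_cochain (K : KummerModule p G M) (H : Subgroup G) {X : G → M}
    (hX : IsLocallyConstant X) {θ : G → G → ZMod p}
    (hθ : ∀ g ∈ H, ∀ h ∈ H, X g + g • X h - X (g * h) = K.ι (θ g h)) :
    ∃ E : G → ZMod p, IsLocallyConstant E ∧
      ∀ g ∈ H, ∀ h ∈ H, E g + E h - E (g * h) = θ g h := by
  obtain ⟨y, hy⟩ := K.hilbert90 H (fun g => p • X g) (hX.comp (p • ·)) fun g hg h hh => by
    have := congrArg (p • ·) (hθ g hg h hh)
    simp only [K.nsmul_ι, nsmul_sub, nsmul_add, sub_eq_zero] at this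
    rw [← this, smul_comm]
  obtain ⟨y, rfl⟩ := K.exists_nsmul_eq y
  have key : ∀ g ∈ H, K.ι (Function.invFun K.ι (X g - (g • y - y))) = X g - (g • y - y) :=
    fun g hg => Function.invFun_eq <| K.exists_ι_eq _ <| by
      rw [nsmul_sub, hy g hg, nsmul_sub, smul_comm, sub_self]
  refine ⟨fun g => Function.invFun K.ι (X g - (g • y - y)),
    hX.comp₂ (K.isLocallyConstant_smul y) fun a b => Function.invFun K.ι (a - (b - y)),
    fun g hg h hh => K.ι_injective ?_⟩
  have h1 : g • (X h - (h • y - y)) = X h - (h • y - y) := by rw [← key h hh, K.smul_ι]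
  rw [map_sub, map_add, key g hg, key h hh, key _ (H.mul_mem hg hh), ← hθ g hg h hh, mul_smul,
    ← h1, smul_sub, smul_sub]
  abel

variable [Fact p.Prime]

/-- If `R` is the root of a character `D` of `ker χa`, and `p • R` is the norm of an element `e`
under the cyclic quotient cut out by `χ`, then `D ∪ χ` is a coboundary on `ker χa`. -/
theorem exists_cochain_of_norm (K : KummerModule p G M) {χa χ D : G → ZMod p}
    (ha : IsCtsChar χa) (hχ : IsCtsChar χ) {τ : G} (hτa : χa τ = 0) (hτ : χ τ = 1) {R e : M}
    (hR : ∀ g : G, χa g = 0 → g • R = R + K.ι (D g))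
    (he : ∀ g : G, χa g = 0 → χ g = 0 → g • e = e)
    (hnorm : p • R = ∑ i ∈ Finset.range p, τ ^ i • e) :
    ∃ E : G → ZMod p, IsLocallyConstant E ∧
      ∀ g h, χa g = 0 → χa h = 0 → E g + E h - E (g * h) = D g * χ h := by
  have hper : Function.Periodic (fun k : ℕ => τ ^ k • e) p := fun k => by
    simp only [pow_add, mul_smul]
    rw [he (τ ^ p) (by simp [ha.map_pow]) (hχ.map_pow_p τ)]
  set Q : ℕ → M := fun k => k • R - ∑ i ∈ Finset.range k, τ ^ i • e with hQdef
  have hQ : Function.Periodic Q p := fun k => by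
    simp only [hQdef, add_smul]
    rw [Finset.sum_range_add, hper.sum_range_add, ← hnorm]
    abel
  obtain ⟨E, hE, hE'⟩ := K.exists_cochain ha.ker (X := fun g => Q (χ g).val)
    (θ := fun g h => D g * χ h) (hχ.isLocallyConstant.comp fun x => Q x.val) fun g hg h hh => by
      have h1 : ∀ i : ℕ, g • τ ^ i • e = τ ^ ((χ g).val + i) • e := fun i => by
        have : (τ ^ ((χ g).val + i))⁻¹ • g • τ ^ i • e = e := by
          rw [← mul_smul, ← mul_smul]
          apply he
          · simp [ha.map_mul, ha.map_inv, ha.map_pow, hτa, ha.mem_ker.1 hg]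
          · simp [hχ.map_mul, hχ.map_inv, hχ.map_pow, hτ]
        rw [inv_smul_eq_iff] at this
        exact this
      have h2 : (χ h).val • K.ι (D g) = K.ι (D g * χ h) := by
        rw [← map_nsmul, nsmul_eq_mul, ZMod.natCast_zmod_val, mul_comm]
      simp only [hχ.map_mul, hQ.val_add_zmod]
      simp only [hQdef, smul_sub, Finset.smul_sum, h1, Finset.sum_range_add, add_smul]
      rw [smul_comm g, hR g hg, smul_add, h2]
      abel
  exact ⟨E, hE, fun g h hg hh => hE' g hg h hh⟩

section Correction

variable {χ χb D : G → ZMod p} {r rb : M} {σ : G}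

/-- The element `σ r - r - rb` is fixed by `ker χ`. -/
theorem smul_defect (K : KummerModule p G M) (hχ : IsCtsChar χ) (hσ : χ σ = 1)
    (hb : ∀ g : G, g • rb = rb + K.ι (χb g))
    (hD : ∀ g h, D (g * h) = D g + D h + χb g * χ h)
    (hr : ∀ g : G, χ g = 0 → g • r = r + K.ι (D g)) {n : G} (hn : χ n = 0) :
    n • (σ • r - r - rb) = σ • r - r - rb := by
  have hn' : χ (σ⁻¹ * n * σ) = 0 := by simp [hχ.map_mul, hχ.map_inv, hn]
  have h1 : n • σ • r = σ • (σ⁻¹ * n * σ) • r := by simp only [← mul_smul]; congr 1; group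
  have h2 : D (σ⁻¹ * n * σ) = D n + χb n := by
    have e1 := hD σ (σ⁻¹ * n * σ)
    have e2 := hD n σ
    rw [show σ * (σ⁻¹ * n * σ) = n * σ by group, hn', e2, hσ] at e1
    linear_combination -e1
  rw [smul_sub, smul_sub, h1, hr _ hn', hr n hn, hb, smul_add, K.smul_ι, h2, map_add]
  abel

/-- The norm of `σ r - r - rb` is `-p • rb`. -/
theorem norm_defect (K : KummerModule p G M) (hχ : IsCtsChar χ) (hσ : χ σ = 1)
    (hb : ∀ g : G, g • rb = rb + K.ι (χb g))
    (hD : ∀ g h, D (g * h) = D g + D h + χb g * χ h)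
    (hr : ∀ g : G, χ g = 0 → g • r = r + K.ι (D g)) (hχ1 : χb 1 = 0) :
    ∑ i ∈ Finset.range p, σ ^ i • (σ • r - r - rb) = -(p • rb) := by
  have key : ∀ k : ℕ, ∑ i ∈ Finset.range k, σ ^ i • (σ • r - r - rb) =
      σ ^ k • r - r - k • rb - K.ι (D (σ ^ k) - k * D σ) := by
    intro k
    induction k with
    | zero =>
      have := hD 1 1
      rw [mul_one, hχ1, zero_mul] at this
      have h0 : D 1 = 0 := by linear_combination -this
      simp [h0]
    | succ k ih =>
      have e := hD (σ ^ k) σ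
      rw [Finset.sum_range_succ, ih, smul_sub, smul_sub, hb, pow_succ, e, hσ, mul_smul]
      simp only [map_sub, map_add, Nat.cast_add, Nat.cast_one, add_mul, one_mul, mul_one, add_smul,
        one_smul]
      abel
  rw [key p, hr _ (hχ.map_pow_p σ)]
  simp

end Correction

/-- The heart of the proof: after correcting `D` by a character of `G`, the corresponding
Kummer element over `ker χa` becomes a norm from `ker χa ⊓ ker χc`. -/
theorem exists_norm (K : KummerModule p G M) {χa χb χc D D' : G → ZMod p}
    (ha : IsCtsChar χa) (hb : IsCtsChar χb) (hc : IsCtsChar χc) {σ τ : G}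
    (hσa : χa σ = 1) (hσc : χc σ = 0) (hτa : χa τ = 0) (hτc : χc τ = 1)
    (hDl : IsLocallyConstant D) (hDl' : IsLocallyConstant D')
    (hD : ∀ g h, D (g * h) = D g + D h + χb g * χa h)
    (hD' : ∀ g h, D' (g * h) = D' g + D' h + χb g * χc h) :
    ∃ (ψ : G → ZMod p) (R e : M), IsCtsChar ψ ∧
      (∀ g : G, χa g = 0 → g • R = R + K.ι (D g - ψ g)) ∧
      (∀ g : G, χa g = 0 → χc g = 0 → g • e = e) ∧
      p • R = ∑ i ∈ Finset.range p, τ ^ i • e := by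
  obtain ⟨rb, hrb⟩ := K.exists_root ⊤ hb.isLocallyConstant fun g _ h _ => hb.map_mul g h
  replace hrb := fun g => hrb g trivial
  obtain ⟨rA, hrA⟩ := K.exists_root ha.ker hDl fun g _ h hh => by
    rw [hD, ha.mem_ker.1 hh]; ring
  obtain ⟨rC, hrC⟩ := K.exists_root hc.ker hDl' fun g _ h hh => by
    rw [hD', hc.mem_ker.1 hh]; ring
  obtain ⟨x, hx⟩ := K.exists_root (ha.sub hc).ker (κ := fun g => D g - D' g)
    (hDl.comp₂ hDl' (· - ·)) fun g _ h hh => by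
      have : χa h - χc h = 0 := (ha.sub hc).mem_ker.1 hh
      rw [hD, hD']; linear_combination χb g * this
  set e : M := rA - rC - x with he_def
  set a := σ • rA - rA - rb with ha_def
  set c := τ • rC - rC - rb with hc_def
  have he : ∀ g : G, χa g = 0 → χc g = 0 → g • e = e := fun g h1 h2 => by
    rw [he_def, smul_sub, smul_sub, hrA g h1, hrC g h2, hx g (by simp [IsCtsChar.mem_ker, h1, h2]),
      map_sub]
    abel
  have hafix : ∀ n : G, χa n = 0 → n • a = a := fun n => K.smul_defect ha hσa hrb hD hrA
  have hcfix : ∀ n : G, χc n = 0 → n • c = c := fun n => K.smul_defect hc hτc hrb hD' hrC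
  have hcnorm := K.norm_defect hc hτc hrb hD' hrC hb.map_one
  have hper : Function.Periodic (fun k : ℕ => τ ^ k • e) p := fun k => by
    simp only [pow_add, mul_smul]
    rw [he (τ ^ p) (by simp [ha.map_pow, hτa]) (hc.map_pow_p τ)]
  obtain ⟨u, hu⟩ : ∃ u, (σ * τ) • e - e = a - c + K.ι u := by
    refine ⟨D τ - D' σ - χb σ - (D (σ * τ) - D' (σ * τ)), ?_⟩
    have h1 : (σ * τ) • x = x + K.ι (D (σ * τ) - D' (σ * τ)) :=
      hx _ (by simp [IsCtsChar.mem_ker, ha.map_mul, hc.map_mul, hσa, hσc, hτa, hτc])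
    have h2 : (σ * τ) • rA = σ • rA + K.ι (D τ) := by
      rw [mul_smul, hrA τ hτa, smul_add, K.smul_ι]
    have h3 : (σ * τ) • rC = c + (rC + K.ι (D' σ)) + (rb + K.ι (χb σ)) := by
      rw [mul_smul, ← hcfix σ hσc, ← hrC σ hσc, ← hrb σ, ← smul_add, ← smul_add, hc_def]
      congr 1
      abel
    rw [he_def, smul_sub, smul_sub, h1, h2, h3, ha_def]
    simp only [map_sub]
    abel
  have hcomm : ∀ i : ℕ, σ • τ ^ (i + 1) • e = τ ^ i • (σ * τ) • e := fun i => by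
    have : (τ ^ i * (σ * τ))⁻¹ • (σ * τ ^ (i + 1)) • e = e := by
      rw [← mul_smul]
      apply he
      · simp [ha.map_mul, ha.map_inv, ha.map_pow, hτa]
      · simp [hc.map_mul, hc.map_inv, hc.map_pow, hτc, hσc]
    rw [inv_smul_eq_iff] at this
    rw [← mul_smul, ← mul_smul, this]
  set N := ∑ i ∈ Finset.range p, τ ^ i • e with hN
  have hN1 : N = ∑ i ∈ Finset.range p, τ ^ (i + 1) • e := by
    rw [hN, ← hper.sum_range_add 1]
    exact Finset.sum_congr rfl fun i _ => by rw [add_comm]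
  have hσN : σ • N - N = p • (σ • rA - rA) := by
    have h1 : σ • N - N = ∑ i ∈ Finset.range p, τ ^ i • (a - c + K.ι u) := by
      rw [← hu]
      nth_rw 1 [hN1]
      rw [hN, Finset.smul_sum, ← Finset.sum_sub_distrib]
      exact Finset.sum_congr rfl fun i _ => by rw [hcomm]; exact (smul_sub _ _ _).symm
    have h2 : ∀ i : ℕ, τ ^ i • a = a := fun i => hafix _ (by simp [ha.map_pow, hτa])
    simp only [smul_add, smul_sub, h2, K.smul_ι, Finset.sum_add_distrib,
      Finset.sum_sub_distrib, Finset.sum_const, Finset.card_range, K.nsmul_ι, hc_def] at h1 hcnorm ⊢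
    rw [h1, hcnorm, ha_def]
    simp only [smul_sub]
    abel
  have hN0 : ∀ g : G, χa g = 0 → g • N = N := fun g hg => by
    rw [hN, Finset.smul_sum, ← hper.sum_range_add (χc g).val]
    refine Finset.sum_congr rfl fun i _ => ?_
    have : (τ ^ ((χc g).val + i))⁻¹ • (g * τ ^ i) • e = e := by
      rw [← mul_smul]
      apply he
      · simp [ha.map_mul, ha.map_inv, ha.map_pow, hτa, hg]
      · simp [hc.map_mul, hc.map_inv, hc.map_pow, hτc]
    rw [inv_smul_eq_iff] at this
    rw [← mul_smul, this]
  obtain ⟨rf, hrf⟩ := K.exists_nsmul_eq (p • rA - N)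
  have hfix : ∀ g : G, g • p • rf = p • rf := fun g => by
    have h1 : σ ∈ MulAction.stabilizer G (p • rf) := by
      rw [MulAction.mem_stabilizer_iff, hrf, smul_sub, smul_comm, sub_eq_sub_iff_sub_eq_sub, hσN,
        smul_sub]
    have h2 : (σ ^ (χa g).val)⁻¹ * g ∈ MulAction.stabilizer G (p • rf) := by
      have h0 := ha.map_inv_pow_mul hσa g
      rw [MulAction.mem_stabilizer_iff, hrf, smul_sub, smul_comm, hrA _ h0, hN0 _ h0, smul_add,
        K.nsmul_ι, add_zero]
    simpa using mul_mem (pow_mem h1 (χa g).val) h2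
  obtain ⟨ψ, hψ, hψr⟩ := K.exists_char hfix
  refine ⟨ψ, rA - rf, e, hψ, fun g hg => ?_, he, ?_⟩
  · rw [smul_sub, hrA g hg, hψr, map_sub]
    abel
  · rw [smul_sub, hrf]
    abel

/-- A normalized cocycle inflated in its second variable from the cyclic quotient cut out by `χ`
is, up to a cup product with `χ`, a coboundary. -/
theorem exists_cochain_of_apply_ker (K : KummerModule p G M) {χ : G → ZMod p} (hχ : IsCtsChar χ)
    {σ : G} (hσ : χ σ = 1) {θ : G → G → ZMod p} (hθl : IsLocallyConstant fun g => θ g σ)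
    (hθ : ∀ g h k, θ h k + θ g (h * k) = θ (g * h) k + θ g h)
    (hθn : ∀ g n, χ n = 0 → θ g n = 0) :
    ∃ ψ E : G → ZMod p, IsCtsChar ψ ∧ IsLocallyConstant E ∧
      ∀ g h, E g + E h - E (g * h) = θ g h + ψ g * χ h := by
  have hmul : ∀ g h n, χ n = 0 → θ g (h * n) = θ g h := fun g h n hn => by
    have := hθ g h n
    rw [hθn _ _ hn, hθn _ _ hn] at this
    linear_combination this
  have hmul' : ∀ g h n, χ n = 0 → θ g (n * h) = θ g h := fun g h n hn => by
    rw [show n * h = h * (h⁻¹ * n * h) by group]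
    exact hmul g h _ (by simp [hχ.map_mul, hχ.map_inv, hn])
  have hone : ∀ h, θ 1 h = 0 := fun h => by
    have := hθ 1 1 h
    rw [one_mul, one_mul, hθn 1 1 hχ.map_one] at this
    linear_combination this
  obtain ⟨y, hy⟩ := K.exists_root hχ.ker (κ := fun g => -θ g σ) (hθl.comp (- ·))
    fun g _ h hh => by
      have := hθ g h σ
      rw [hmul' g σ h hh, hθn g h hh] at this
      linear_combination this
  let P : ℕ → M := fun k => Nat.rec 0 (fun k m => y + σ • m + K.ι (θ σ (σ ^ k))) k
  have hP0 : P 0 = 0 := rfl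
  have hPs : ∀ k, P (k + 1) = y + σ • P k + K.ι (θ σ (σ ^ k)) := fun _ => rfl
  clear_value P
  have hPadd : ∀ i j, P (i + j) = P i + σ ^ i • P j + K.ι (θ (σ ^ i) (σ ^ j)) := by
    intro i j
    induction i with
    | zero => simp [hP0, hone]
    | succ i ih =>
      have h1 := hθ σ (σ ^ i) (σ ^ j)
      rw [← pow_add, ← pow_succ'] at h1
      have h2 : K.ι (θ (σ ^ i) (σ ^ j)) + K.ι (θ σ (σ ^ (i + j))) =
          K.ι (θ (σ ^ (i + 1)) (σ ^ j)) + K.ι (θ σ (σ ^ i)) := by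
        rw [← map_add, h1, map_add]
      rw [show i + 1 + j = i + j + 1 by ring, hPs, hPs, ih, smul_add, smul_add, K.smul_ι,
        pow_succ' σ i, mul_smul, ← pow_succ', add_assoc y, add_assoc (σ • P i + _), add_assoc y,
        add_assoc, h2]
      abel
  have hPn : ∀ k n, χ n = 0 → n • P k = P k - K.ι (θ n (σ ^ k)) := by
    intro k
    induction k with
    | zero => intro n hn; simp [hP0, hθn n 1 hχ.map_one]
    | succ k ih =>
      intro n hn
      have hn' : χ (σ⁻¹ * n * σ) = 0 := by simp [hχ.map_mul, hχ.map_inv, hn]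
      have h1 : n • σ • P k = σ • (σ⁻¹ * n * σ) • P k := by simp only [← mul_smul]; congr 1; group
      have h2 : θ n (σ ^ (k + 1)) = θ n σ + θ (σ⁻¹ * n * σ) (σ ^ k) := by
        have e1 := hθ n σ (σ ^ k)
        have e2 := hθ σ (σ⁻¹ * n * σ) (σ ^ k)
        rw [show σ * (σ⁻¹ * n * σ) = n * σ by group, hmul' _ _ _ hn', hθn σ _ hn'] at e2
        rw [← pow_succ'] at e1
        linear_combination e1 - e2
      rw [hPs, smul_add, smul_add, K.smul_ι, h1, ih _ hn', hy n hn, smul_sub, K.smul_ι, h2,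
        map_neg, map_add]
      abel
  have hσp : χ (σ ^ p) = 0 := hχ.map_pow_p σ
  have hPσ : σ • P p = P p := by
    have h1 := hPadd p 1
    have h2 : P 1 = y := by rw [hPs 0, hP0, pow_zero, hθn σ 1 hχ.map_one]; simp
    rw [hPs, hθn _ _ hσp, h2, hy _ hσp, pow_one, map_neg, map_zero] at h1
    have : y + σ • P p = y + P p := by rw [add_zero] at h1; rw [h1]; abel
    exact add_left_cancel this
  obtain ⟨r, hr⟩ := K.exists_nsmul_eq (P p)
  have hfix : ∀ g : G, g • p • r = p • r := fun g => by
    have h1 : σ ∈ MulAction.stabilizer G (p • r) := by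
      rw [MulAction.mem_stabilizer_iff, hr, hPσ]
    have h2 : (σ ^ (χ g).val)⁻¹ * g ∈ MulAction.stabilizer G (p • r) := by
      rw [MulAction.mem_stabilizer_iff, hr, hPn _ _ (hχ.map_inv_pow_mul hσ g), hθn _ _ hσp,
        map_zero, sub_zero]
    simpa using mul_mem (pow_mem h1 (χ g).val) h2
  obtain ⟨ψ, hψ, hψr⟩ := K.exists_char hfix
  set Q : ℕ → M := fun k => P k - k • r with hQdef
  have hQ : Function.Periodic Q p := fun k => by
    simp only [hQdef, hPadd, ← hr, hfix, hθn _ _ hσp, map_zero, add_smul]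
    abel
  obtain ⟨E, hE, hE'⟩ := K.exists_cochain ⊤ (X := fun g => Q (χ g).val)
    (θ := fun g h => -(θ g h + ψ g * χ h)) (hχ.isLocallyConstant.comp fun x => Q x.val)
    fun g _ h _ => by
      have hn := hχ.map_inv_pow_mul hσ g
      have hm := hχ.map_inv_pow_mul hσ h
      simp only [hχ.map_mul, hQ.val_add_zmod]
      generalize hk : (χ g).val = k at *
      generalize hj : (χ h).val = j at *
      have hjh : (j : ZMod p) = χ h := by rw [← hj, ZMod.natCast_zmod_val]
      have h1 : g • P j = σ ^ k • ((σ ^ k)⁻¹ * g) • P j := by rw [← mul_smul]; congr 1; group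
      have h2 : θ g h = θ ((σ ^ k)⁻¹ * g) (σ ^ j) + θ (σ ^ k) (σ ^ j) := by
        have e1 := hmul g (σ ^ j) _ hm
        have e2 := hθ (σ ^ k) ((σ ^ k)⁻¹ * g) (σ ^ j)
        rw [hmul' _ _ _ hn, hθn _ _ hn, mul_inv_cancel_left] at e2
        rw [mul_inv_cancel_left] at e1
        linear_combination e1 - e2
      have h3 : j • K.ι (ψ g) = K.ι (ψ g * χ h) := by
        rw [← map_nsmul, nsmul_eq_mul, hjh, mul_comm]
      simp only [hQdef, hPadd, smul_sub, smul_comm g j r, hψr, smul_add, h1, hPn _ _ hn, K.smul_ι,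
        h2, h3, add_smul, map_neg, map_add]
      abel
  refine ⟨ψ, fun g => -E g, hψ, hE.comp (- ·), fun g h => ?_⟩
  linear_combination -hE' g trivial h trivial

/-- A normalized cocycle which is a coboundary on `ker χ` is cohomologous to a cup product
with `χ`. -/
theorem exists_cochain_of_ker [IsTopologicalGroup G] (K : KummerModule p G M) {χ : G → ZMod p}
    (hχ : IsCtsChar χ) {σ : G} (hσ : χ σ = 1) {θ : G → G → ZMod p}
    (hθl : ∀ g, IsLocallyConstant fun h => θ h g) (hθr : ∀ g, IsLocallyConstant (θ g))
    (hθ : ∀ g h k, θ h k + θ g (h * k) = θ (g * h) k + θ g h)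
    (hone : ∀ g, θ 1 g = 0)
    {ε : G → ZMod p} (hεl : IsLocallyConstant ε)
    (hε : ∀ n m, χ n = 0 → χ m = 0 → ε n + ε m - ε (n * m) = θ n m) :
    ∃ ψ E : G → ZMod p, IsCtsChar ψ ∧ IsLocallyConstant E ∧
      ∀ g h, E g + E h - E (g * h) = θ g h + ψ g * χ h := by
  let T : ZMod p → G → ZMod p := fun x g =>
    ε ((σ ^ x.val)⁻¹ * g) - θ (σ ^ x.val) ((σ ^ x.val)⁻¹ * g)
  have hT : ∀ x, IsLocallyConstant (T x) := fun x =>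
    (hεl.comp_continuous (continuous_const_mul (σ ^ x.val)⁻¹)).comp₂
      ((hθr (σ ^ x.val)).comp_continuous (continuous_const_mul (σ ^ x.val)⁻¹)) (· - ·)
  set ε' : G → ZMod p := fun g => T (χ g) g with hε'
  have hε'l : IsLocallyConstant ε' := hχ.isLocallyConstant.apply₂ hT
  have hε1 : ε 1 = 0 := by
    have := hε 1 1 hχ.map_one hχ.map_one
    rw [hone, mul_one] at this
    linear_combination this
  have hker : ∀ n, χ n = 0 → ε' n = ε n := fun n hn => by simp [hε', T, hn, hone]
  have hpow : ∀ (x : ZMod p) n, χ n = 0 →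
      ε' (σ ^ x.val * n) = ε n - θ (σ ^ x.val) n := fun x n hn => by
    have : χ (σ ^ x.val * n) = x := by
      rw [hχ.map_mul, hχ.map_pow, hσ, hn, ZMod.natCast_zmod_val]; ring
    simp only [hε', this, T, inv_mul_cancel_left]
  have hnorm : ∀ g n, χ n = 0 → θ g n - (ε' g + ε' n - ε' (g * n)) = 0 := fun g n hn => by
    have hm := hχ.map_inv_pow_mul hσ g
    have hg : g = σ ^ (χ g).val * ((σ ^ (χ g).val)⁻¹ * g) := by group
    generalize (σ ^ (χ g).val)⁻¹ * g = m at hm hg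
    generalize χ g = x at hg
    subst hg
    have e := hθ (σ ^ x.val) m n
    rw [mul_assoc, hpow x m hm, hpow x (m * n) (by rw [hχ.map_mul, hm, hn, add_zero]), hker n hn]
    linear_combination -e - hε m n hm hn
  obtain ⟨ψ, E, hψ, hE, h⟩ := K.exists_cochain_of_apply_ker hχ hσ
    (θ := fun g h => θ g h - (ε' g + ε' h - ε' (g * h)))
    ((hθl σ).comp₂ ((hε'l.comp (· + ε' σ)).comp₂
      (hε'l.comp_continuous (continuous_mul_const σ)) (· - ·)) (· - ·))
    (fun g h k => by simp only [mul_assoc]; linear_combination hθ g h k) hnorm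
  exact ⟨ψ, fun g => E g + ε' g, hψ, hE.comp₂ hε'l (· + ·), fun g h' => by
    linear_combination h g h'⟩

/-- Triple Massey products of continuous characters contain zero as soon as they are defined. -/
theorem massey_contains_zero [IsTopologicalGroup G] (K : KummerModule p G M)
    {χa χb χc D₁ D₂ : G → ZMod p}
    (ha : IsCtsChar χa) (hb : IsCtsChar χb) (hc : IsCtsChar χc)
    (hD₁l : IsLocallyConstant D₁) (hD₂l : IsLocallyConstant D₂)
    (hD₁ : ∀ g h, D₁ g + D₁ h - D₁ (g * h) = χa g * χb h)
    (hD₂ : ∀ g h, D₂ g + D₂ h - D₂ (g * h) = χb g * χc h) :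
    ∃ D₁₂ D₂₃ E : G → ZMod p,
      IsLocallyConstant D₁₂ ∧ IsLocallyConstant D₂₃ ∧ IsLocallyConstant E ∧
      (∀ g h, D₁₂ g + D₁₂ h - D₁₂ (g * h) = χa g * χb h) ∧
      (∀ g h, D₂₃ g + D₂₃ h - D₂₃ (g * h) = χb g * χc h) ∧
      ∀ g h, E g + E h - E (g * h) = χa g * D₂₃ h + D₁₂ g * χc h := by
  by_cases hχa : ∀ g, χa g = 0
  · exact ⟨0, D₂, 0, .const 0, hD₂l, .const 0, by simp [hχa], hD₂, by simp [hχa]⟩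
  obtain ⟨σ, hσ⟩ : ∃ σ, χa σ = 1 := by
    push Not at hχa
    obtain ⟨g, hg⟩ := hχa
    obtain ⟨k, hk⟩ := ha.exists_eq_one hg
    exact ⟨_, hk⟩
  obtain ⟨ψ, ε, hψ, hεl, hε⟩ : ∃ ψ ε : G → ZMod p, IsCtsChar ψ ∧ IsLocallyConstant ε ∧
      ∀ g h, χa g = 0 → χa h = 0 → ε g + ε h - ε (g * h) = (D₁ g - ψ g) * χc h := by
    by_cases hχc : ∀ g, χa g = 0 → χc g = 0
    · exact ⟨0, 0, ⟨.const 0, by simp⟩, .const 0, fun g h _ hh => by simp [hχc h hh]⟩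
    obtain ⟨τ, hτa, hτc⟩ : ∃ τ, χa τ = 0 ∧ χc τ = 1 := by
      push Not at hχc
      obtain ⟨g, hg, hg'⟩ := hχc
      obtain ⟨k, hk⟩ := hc.exists_eq_one hg'
      exact ⟨_, by simp [ha.map_pow, hg], hk⟩
    obtain ⟨ψ, R, e, hψ, hR, he, hnorm⟩ := K.exists_norm ha hb hc
      (σ := (τ ^ (χc σ).val)⁻¹ * σ) (τ := τ) (D := fun g => D₁ g + χa g * χb g)
      (D' := fun g => -D₂ g)
      (by simp [ha.map_mul, ha.map_inv, ha.map_pow, hτa, hσ]) (hc.map_inv_pow_mul hτc σ) hτa hτc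
      (hD₁l.comp₂ (ha.isLocallyConstant.comp₂ hb.isLocallyConstant (· * ·)) (· + ·))
      (hD₂l.comp (- ·))
      (fun g h => by rw [ha.map_mul, hb.map_mul]; linear_combination -hD₁ g h)
      (fun g h => by linear_combination hD₂ g h)
    obtain ⟨ε, hεl, hε⟩ := K.exists_cochain_of_norm ha hc (D := fun g => D₁ g - ψ g) hτa hτc
      (fun g hg => by rw [hR g hg, hg, zero_mul, add_zero]) he hnorm
    exact ⟨ψ, ε, hψ, hεl, hε⟩
  set D : G → ZMod p := fun g => D₁ g - ψ g with hD_def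
  have hDl : IsLocallyConstant D := hD₁l.comp₂ hψ.isLocallyConstant (· - ·)
  have hD : ∀ g h, D g + D h - D (g * h) = χa g * χb h := fun g h => by
    rw [hD_def]; dsimp only; rw [hψ.map_mul]; linear_combination hD₁ g h
  have hD1 : D 1 = 0 := by simpa [ha.map_one] using hD 1 1
  obtain ⟨φ, E, hφ, hE, hEθ⟩ := K.exists_cochain_of_ker ha hσ
    (θ := fun g h => χa g * D₂ h + D g * χc h)
    (fun g => ha.isLocallyConstant.comp₂ hDl fun x y => x * D₂ g + y * χc g)
    (fun g => hD₂l.comp₂ hc.isLocallyConstant fun x y => χa g * x + D g * y)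
    (fun g h k => by
      rw [ha.map_mul, hc.map_mul]
      linear_combination χa g * (-hD₂ h k) + hD g h * χc k)
    (fun g => by simp [ha.map_one, hD1]) hεl
    (fun n m hn hm => by rw [hε n m hn hm, hn]; ring)
  refine ⟨D, fun g => D₂ g - φ g, fun g => E g + χa g * φ g, hDl,
    hD₂l.comp₂ hφ.isLocallyConstant (· - ·),
    hE.comp₂ (ha.isLocallyConstant.comp₂ hφ.isLocallyConstant (· * ·)) (· + ·), hD,
    fun g h => ?_, fun g h => ?_⟩
  · dsimp only; rw [hφ.map_mul]; linear_combination hD₂ g h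
  · dsimp only; rw [ha.map_mul, hφ.map_mul]; linear_combination hEθ g h

end KummerModule

/-! ### The multiplicative group of a separable closure -/

section Galois

variable {F Fs : Type*} [Field F] [Field Fs] [Algebra F Fs]

/-- Hilbert 90 for continuous cocycles on a subgroup of the group of automorphisms of an
extension of fields. -/
theorem exists_apply_eq_mul_of_isLocallyConstant (H : Subgroup (Fs ≃ₐ[F] Fs))
    {w : (Fs ≃ₐ[F] Fs) → Fs} (hw : IsLocallyConstant w) (hw0 : ∀ g ∈ H, w g ≠ 0)
    (hmul : ∀ g ∈ H, ∀ h ∈ H, w (g * h) = w g * g (w h)) :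
    ∃ y ≠ 0, ∀ g ∈ H, g y = w g * y := by
  classical
  have hw1 : w 1 = 1 := by
    have := hmul 1 H.one_mem 1 H.one_mem
    rw [mul_one, AlgEquiv.one_apply] at this
    exact mul_left_cancel₀ (hw0 1 H.one_mem) (by rw [← this, mul_one])
  obtain ⟨K, hK, hKw⟩ := (krullTopology_mem_nhds_one_iff F Fs {g | w g = 1}).1 <| by
    have h := hw.eventually_eq 1
    rw [hw1] at h
    exact h
  have := hK
  let res : (Fs ≃ₐ[F] Fs) → (K →ₐ[F] Fs) := fun g => (g : Fs →ₐ[F] Fs).comp K.val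
  have hres : ∀ g ∈ H, ∀ h ∈ H, res g = res h → w g = w h := fun g hg h hh e => by
    have h1 : w (g⁻¹ * h) = 1 := hKw <| by
      rw [SetLike.mem_coe, IntermediateField.mem_fixingSubgroup_iff]
      intro x hx
      have := DFunLike.congr_fun e (⟨x, hx⟩ : K)
      change g x = h x at this
      rw [AlgEquiv.mul_apply, ← this]
      exact g.symm_apply_apply x
    have h2 := hmul g hg _ (H.mul_mem (H.inv_mem hg) hh)
    rw [h1, map_one, mul_one, mul_inv_cancel_left] at h2
    exact h2.symm
  let W : (K →ₐ[F] Fs) → Fs := fun φ => if h : ∃ g ∈ H, res g = φ then w h.choose else 0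
  have hW : ∀ g ∈ H, W (res g) = w g := fun g hg => by
    have h : ∃ g' ∈ H, res g' = res g := ⟨g, hg, rfl⟩
    simp only [W, dif_pos h]
    exact hres _ h.choose_spec.1 _ hg h.choose_spec.2
  have hW' : ∀ φ, (¬ ∃ g ∈ H, res g = φ) → W φ = 0 := fun φ h => dif_neg h
  let T : (Fs ≃ₐ[F] Fs) → (K →ₐ[F] Fs) → (K →ₐ[F] Fs) := fun g φ => (g : Fs →ₐ[F] Fs).comp φ
  have hT : ∀ g, Function.Bijective (T g) := fun g => by
    refine Function.bijective_iff_has_inverse.2 ⟨T g⁻¹, fun φ => ?_, fun φ => ?_⟩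
    · ext x; exact g.symm_apply_apply _
    · ext x; exact g.apply_symm_apply _
  have hWT : ∀ g ∈ H, ∀ φ, w g * g (W φ) = W (T g φ) := fun g hg φ => by
    by_cases h : ∃ h ∈ H, res h = φ
    · obtain ⟨h, hh, rfl⟩ := h
      rw [hW h hh, ← hmul g hg h hh, ← hW _ (H.mul_mem hg hh)]
      rfl
    · rw [hW' φ h, map_zero, mul_zero, hW']
      rintro ⟨h', hh', e⟩
      refine h ⟨g⁻¹ * h', H.mul_mem (H.inv_mem hg) hh', (hT g).1 ?_⟩
      rw [← e]
      ext x
      exact g.apply_symm_apply _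
  obtain ⟨x, hx⟩ : ∃ x : K, ∑ φ : K →ₐ[F] Fs, W φ * φ x ≠ 0 := by
    by_contra! hzero
    have := Fintype.linearIndependent_iff.1 (linearIndependent_toLinearMap F K Fs) W
      (by ext x; simpa using hzero x) (res 1)
    rw [hW 1 H.one_mem, hw1] at this
    exact one_ne_zero this
  refine ⟨(∑ φ : K →ₐ[F] Fs, W φ * φ x)⁻¹, inv_ne_zero hx, fun g hg => ?_⟩
  have key : w g * g (∑ φ : K →ₐ[F] Fs, W φ * φ x) = ∑ φ : K →ₐ[F] Fs, W φ * φ x := by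
    rw [map_sum, Finset.mul_sum, ← (hT g).sum_comp fun φ => W φ * φ x]
    refine Finset.sum_congr rfl fun φ _ => ?_
    rw [map_mul, ← mul_assoc, hWT g hg]
    rfl
  rw [map_inv₀]
  nth_rw 2 [← key]
  rw [mul_inv, mul_inv_cancel_left₀ (hw0 g hg)]

theorem isLocallyConstant_algEquiv_apply [Algebra.IsIntegral F Fs] (x : Fs) :
    IsLocallyConstant fun g : Fs ≃ₐ[F] Fs => g x := by
  rw [IsLocallyConstant.iff_eventually_eq]
  intro g
  have : FiniteDimensional F (IntermediateField.adjoin F {x}) :=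
    IntermediateField.adjoin.finiteDimensional (Algebra.IsIntegral.isIntegral x)
  have h1 : ∀ᶠ h in nhds (1 : Fs ≃ₐ[F] Fs), h x = x := by
    filter_upwards [(IntermediateField.fixingSubgroup_isOpen
      (IntermediateField.adjoin F {x})).mem_nhds (one_mem _)] with h hh
    exact (IntermediateField.mem_fixingSubgroup_iff _ _).1 hh x
      (IntermediateField.mem_adjoin_simple_self F x)
  have h2 : Filter.Tendsto (fun h => g⁻¹ * h) (nhds g) (nhds 1) := by
    simpa using (continuous_const_mul g⁻¹).tendsto g
  filter_upwards [h2.eventually h1] with h hh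
  rw [AlgEquiv.mul_apply] at hh
  calc h x = g (g⁻¹ (h x)) := (g.apply_symm_apply _).symm
    _ = g x := by rw [hh]

/-- Automorphisms act on the multiplicative group, written additively. -/
instance : DistribMulAction (Fs ≃ₐ[F] Fs) (Additive Fsˣ) where
  smul g x := Additive.ofMul (g • x.toMul)
  one_smul x := congrArg Additive.ofMul (one_smul _ x.toMul)
  mul_smul g h x := congrArg Additive.ofMul (mul_smul g h x.toMul)
  smul_zero g := congrArg Additive.ofMul (smul_one g)
  smul_add g x y := congrArg Additive.ofMul (smul_mul' g x.toMul y.toMul)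

theorem coe_toMul_smul (g : Fs ≃ₐ[F] Fs) (x : Additive Fsˣ) :
    (((g • x).toMul : Fsˣ) : Fs) = g (x.toMul : Fsˣ) := rfl

theorem Additive.unit_ext {x y : Additive Fsˣ} (h : ((x.toMul : Fsˣ) : Fs) = (y.toMul : Fsˣ)) :
    x = y :=
  Additive.toMul.injective (Units.ext h)

theorem IsPrimitiveRoot.pow_val_add {p : ℕ} [NeZero p] {ζ : Fs} (hζ : IsPrimitiveRoot ζ p)
    (x y : ZMod p) : ζ ^ (x + y).val = ζ ^ x.val * ζ ^ y.val := by
  rw [ZMod.val_add, ← pow_add]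
  conv_rhs => rw [← Nat.mod_add_div (x.val + y.val) p, pow_add, pow_mul, hζ.pow_eq_one, one_pow,
    mul_one]

theorem IsPrimitiveRoot.pow_val_injective {p : ℕ} [NeZero p] {ζ : Fs}
    (hζ : IsPrimitiveRoot ζ p) : Function.Injective fun x : ZMod p => ζ ^ x.val := fun x y h =>
  ZMod.val_injective p (hζ.pow_inj (ZMod.val_lt x) (ZMod.val_lt y) h)

/-- The multiplicative group of a separable closure is a Kummer module. -/
noncomputable def kummerModuleUnits {p : ℕ} [Fact p.Prime] [IsSepClosure F Fs] {ξ : F}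
    (hξ : IsPrimitiveRoot ξ p) : KummerModule p (Fs ≃ₐ[F] Fs) (Additive Fsˣ) :=
  have hζ : IsPrimitiveRoot (algebraMap F Fs ξ) p := hξ.map_of_injective (algebraMap F Fs).injective
  have hζ0 : algebraMap F Fs ξ ≠ 0 := hζ.ne_zero (NeZero.ne p)
  have hcoe (m : Additive Fsˣ) : (((p • m).toMul : Fsˣ) : Fs) = ((m.toMul : Fsˣ) : Fs) ^ p := rfl
  { ι :=
      { toFun := fun x => Additive.ofMul (Units.mk0 _ hζ0 ^ x.val)
        map_zero' := by simp
        map_add' := fun x y => Additive.unit_ext <| by simpa using hζ.pow_val_add x y }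
    ι_injective := fun x y h => hζ.pow_val_injective <| by
      simpa using congrArg (fun m : Additive Fsˣ => ((m.toMul : Fsˣ) : Fs)) h
    smul_ι := fun g x => Additive.unit_ext <| by
      rw [coe_toMul_smul]
      simp
    exists_ι_eq := fun m hm => by
      have h1 : ((m.toMul : Fsˣ) : Fs) ^ p = 1 := by
        rw [← hcoe, hm]; rfl
      obtain ⟨i, hi, e⟩ := hζ.eq_pow_of_pow_eq_one h1
      refine ⟨i, Additive.unit_ext ?_⟩
      simp [ZMod.val_natCast_of_lt hi, e]
    exists_nsmul_eq := fun m => by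
      have : IsSepClosed Fs := IsSepClosure.sep_closed F
      have : NeZero (p : Fs) := hζ.neZero'
      obtain ⟨z, hz⟩ := IsSepClosed.exists_pow_nat_eq ((m.toMul : Fsˣ) : Fs) p
      have hz0 : z ≠ 0 := by
        rintro rfl
        rw [zero_pow (NeZero.ne p)] at hz
        exact (m.toMul : Fsˣ).ne_zero hz.symm
      exact ⟨Additive.ofMul (Units.mk0 z hz0), Additive.unit_ext hz⟩
    isLocallyConstant_smul := fun m => by
      have : Algebra.IsSeparable F Fs := IsSepClosure.separable
      exact IsLocallyConstant.desc _ (fun x : Additive Fsˣ => ((x.toMul : Fsˣ) : Fs))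
        (isLocallyConstant_algEquiv_apply ((m.toMul : Fsˣ) : Fs))
        fun _ _ => Additive.unit_ext
    hilbert90 := fun H w hw hmul => by
      obtain ⟨y, hy0, hy⟩ := exists_apply_eq_mul_of_isLocallyConstant H
        (hw.comp fun x : Additive Fsˣ => ((x.toMul : Fsˣ) : Fs)) (fun g _ => Units.ne_zero _)
        fun g hg h hh => by
          rw [Function.comp_apply, hmul g hg h hh]
          rfl
      refine ⟨Additive.ofMul (Units.mk0 y hy0), fun g hg => ?_⟩
      rw [eq_sub_iff_add_eq]
      exact Additive.unit_ext (hy g hg).symm }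

theorem cts_iff_isLocallyConstant {X : Type*} [TopologicalSpace X] {p : ℕ} {f : X → ZMod p} :
    Cts f ↔ IsLocallyConstant f :=
  IsLocallyConstant.iff_isOpen_fiber.symm

theorem IsKummerChar.isCtsChar {p : ℕ} [NeZero p] {ξ : F} (hξ : IsPrimitiveRoot ξ p) {r : Fs}
    (hr : r ≠ 0) {χ : (Fs ≃ₐ[F] Fs) → ZMod p} (hχ : IsKummerChar ξ r χ) (hcts : Cts χ) :
    IsCtsChar χ where
  isLocallyConstant := cts_iff_isLocallyConstant.1 hcts
  map_mul g h := by
    have hζ : IsPrimitiveRoot (algebraMap F Fs ξ) p :=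
      hξ.map_of_injective (algebraMap F Fs).injective
    apply hζ.pow_val_injective
    apply mul_right_cancel₀ hr
    change _ ^ (χ (g * h)).val * r = _ ^ (χ g + χ h).val * r
    rw [← hχ, hζ.pow_val_add, AlgEquiv.mul_apply, hχ h, map_mul, hχ g, map_pow, AlgEquiv.commutes]
    ring

end Galois

/-- Let `p` be a prime and `F` a field containing a primitive `p`-th root of unity `ξ`,
with separable closure `Fs` and absolute Galois group `G_F = Fs ≃ₐ[F] Fs`, and let
`a, b, c ∈ F^×` with Kummer characters `χ_a, χ_b, χ_c`. If the triple Massey product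
`⟨χ_a, χ_b, χ_c⟩` is defined (both `χ_a ∪ χ_b` and `χ_b ∪ χ_c` are coboundaries of
continuous 1-cochains), then it contains `0`. -/
theorem triple_massey_contains_zero (p : ℕ) [Fact p.Prime]
    (F Fs : Type*) [Field F] [Field Fs] [Algebra F Fs] [IsSepClosure F Fs]
    (ξ : F) (hξ : IsPrimitiveRoot ξ p)
    (a b c : F) (ha : a ≠ 0) (hb : b ≠ 0) (hc : c ≠ 0)
    (ra rb rc : Fs) (hra : ra ^ p = algebraMap F Fs a) (hrb : rb ^ p = algebraMap F Fs b)
    (hrc : rc ^ p = algebraMap F Fs c)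
    (χa χb χc : (Fs ≃ₐ[F] Fs) → ZMod p)
    (hχa : IsKummerChar ξ ra χa) (hχb : IsKummerChar ξ rb χb) (hχc : IsKummerChar ξ rc χc)
    (hχa_cts : Cts χa) (hχb_cts : Cts χb) (hχc_cts : Cts χc)
    (hdefined : ∃ D₁₂ D₂₃ : (Fs ≃ₐ[F] Fs) → ZMod p, Cts D₁₂ ∧ Cts D₂₃ ∧
      cob D₁₂ = cup χa χb ∧ cob D₂₃ = cup χb χc) :
    ∃ D₁₂ D₂₃ E : (Fs ≃ₐ[F] Fs) → ZMod p, Cts D₁₂ ∧ Cts D₂₃ ∧ Cts E ∧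
      cob D₁₂ = cup χa χb ∧ cob D₂₃ = cup χb χc ∧
      cob E = fun σ τ => χa σ * D₂₃ τ + D₁₂ σ * χc τ := by
  have ne_zero {x : F} {r : Fs} (hx : x ≠ 0) (h : r ^ p = algebraMap F Fs x) : r ≠ 0 := by
    rintro rfl
    rw [zero_pow (NeZero.ne p)] at h
    exact hx ((map_eq_zero (algebraMap F Fs)).1 h.symm)
  obtain ⟨D₁, D₂, hD₁c, hD₂c, hD₁, hD₂⟩ := hdefined
  obtain ⟨D₁₂, D₂₃, E, h1, h2, h3, h4, h5, h6⟩ :=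
    (kummerModuleUnits (Fs := Fs) hξ).massey_contains_zero
      (hχa.isCtsChar hξ (ne_zero ha hra) hχa_cts) (hχb.isCtsChar hξ (ne_zero hb hrb) hχb_cts)
      (hχc.isCtsChar hξ (ne_zero hc hrc) hχc_cts) (cts_iff_isLocallyConstant.1 hD₁c)
      (cts_iff_isLocallyConstant.1 hD₂c) (congr_fun₂ hD₁) (congr_fun₂ hD₂)
  exact ⟨D₁₂, D₂₃, E, cts_iff_isLocallyConstant.2 h1, cts_iff_isLocallyConstant.2 h2,
    cts_iff_isLocallyConstant.2 h3, funext₂ h4, funext₂ h5, funext₂ h6⟩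
end

section
/- Assume a, b ∈ F^× are linearly independent modulo (F^×)^p, let A = f_a·A₀ be as in the setup, let φ_ab : G_F → 𝔽_p be a continuous map with ∂φ_ab = χ_a ∪ χ_b whose restriction to H := G_{F(a^{1/p})} = ker χ_a equals −χ_A, and let c ∈ F^× and φ_bc : G_F → 𝔽_p be a continuous map with ∂φ_bc = χ_b ∪ χ_c. Then the restriction to H of the 2-cocycle χ_a ∪ φ_bc + φ_ab ∪ χ_c is cohomologous to (χ_c|_H) ∪ χ_A; that is, there is a continuous map ψ : H → 𝔽_p with (χ_a ∪ φ_bc + φ_ab ∪ χ_c)|_{H×H} − (χ_c|_H) ∪ χ_A = ∂ψ. -/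
/-- `a` and `b` are linearly independent modulo `(F^×)^p`. -/
def LinIndepModP (p : ℕ) {F : Type*} [Field F] (a b : F) : Prop :=
  ∀ m n : ℤ, (∃ y : F, y ≠ 0 ∧ a ^ m * b ^ n = y ^ (p : ℤ)) → (p : ℤ) ∣ m ∧ (p : ℤ) ∣ n

/-- A Kummer character attached to a nonzero element is additive. -/
theorem IsKummerChar.apply_mul {F Fs : Type*} [Field F] [Field Fs] [Algebra F Fs] {p : ℕ}
    [NeZero p] {ξ : F} (hξ : IsPrimitiveRoot ξ p) {r : Fs} (hr : r ≠ 0)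
    {χ : (Fs ≃ₐ[F] Fs) → ZMod p} (hχ : IsKummerChar ξ r χ) (σ τ : Fs ≃ₐ[F] Fs) :
    χ (σ * τ) = χ σ + χ τ := by
  have hξ' : IsPrimitiveRoot (algebraMap F Fs ξ) p :=
    hξ.map_of_injective (algebraMap F Fs).injective
  have h : algebraMap F Fs ξ ^ (χ (σ * τ)).val =
      algebraMap F Fs ξ ^ ((χ σ).val + (χ τ).val) := by
    apply mul_right_cancel₀ hr
    rw [← hχ, AlgEquiv.mul_apply, hχ τ, map_mul, map_pow, AlgEquiv.commutes, hχ σ, pow_add]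
    ring
  rw [(hξ'.isOfFinOrder (NeZero.ne p)).pow_eq_pow_iff_modEq, ← hξ'.eq_orderOf, ← ZMod.natCast_eq_natCast_iff] at h
  simpa using h

theorem Cts.isLocallyConstant {G : Type*} [TopologicalSpace G] {p : ℕ} {f : G → ZMod p}
    (hf : Cts f) : IsLocallyConstant f :=
  IsLocallyConstant.iff_isOpen_fiber.mpr hf

/-- Let `p` be a prime, `F` a field containing a primitive `p`-th root of unity `ξ`,
with separable closure `Fs` and `G_F = Fs ≃ₐ[F] Fs`. Let `a, b ∈ F^×` be linearly
independent modulo `(F^×)^p` with Kummer characters `χ_a, χ_b`, let `K = F(a^{1/p})`,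
`σ_a` the generator of `Gal(K/F)` with `σ_a(rK) = ξ·rK`, `α ∈ K^×` with
`N_{K/F}(α) = b`, `A = f_a·∏_{i=0}^{p-2} σ_a^i(α^{p-1-i})` with `p`-th root `rA ∈ Fs`,
and `χ_A` the Kummer character of `A` over `K`, defined on `H := ker χ_a = G_K`. Let
`φ_ab : G_F → 𝔽_p` be a continuous map with `∂φ_ab = χ_a ∪ χ_b` and `φ_ab|_H = −χ_A`,
let `c ∈ F^×` with Kummer character `χ_c`, and let `φ_bc : G_F → 𝔽_p` be a continuous
map with `∂φ_bc = χ_b ∪ χ_c`. Then the restriction to `H` of the 2-cocycle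
`χ_a ∪ φ_bc + φ_ab ∪ χ_c` is cohomologous to `(χ_c|_H) ∪ χ_A`: there is a continuous
map `ψ : H → 𝔽_p` with
`(χ_a ∪ φ_bc + φ_ab ∪ χ_c)|_{H×H} − (χ_c|_H) ∪ χ_A = ∂ψ`. -/
theorem restriction_of_massey_cocycle (p : ℕ) [Fact p.Prime]
    (F K Fs : Type*) [Field F] [Field K] [Field Fs]
    [Algebra F K] [Algebra K Fs] [Algebra F Fs] [IsScalarTower F K Fs]
    [IsSepClosure F Fs] [FiniteDimensional F K]
    (ξ : F) (hξ : IsPrimitiveRoot ξ p)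
    (a b c : F) (ha : a ≠ 0) (hb : b ≠ 0) (hc : c ≠ 0) (hab : LinIndepModP p a b)
    (rK : K) (hrK : rK ^ p = algebraMap F K a) (hKadj : Algebra.adjoin F {rK} = ⊤)
    (σa : K ≃ₐ[F] K) (hσa : σa rK = algebraMap F K ξ * rK)
    (rb rc : Fs) (hrb : rb ^ p = algebraMap F Fs b) (hrc : rc ^ p = algebraMap F Fs c)
    (χa χb χc : (Fs ≃ₐ[F] Fs) → ZMod p)
    (hχa : IsKummerChar ξ (algebraMap K Fs rK) χa) (hχb : IsKummerChar ξ rb χb)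
    (hχc : IsKummerChar ξ rc χc)
    (hχa_cts : Cts χa) (hχb_cts : Cts χb) (hχc_cts : Cts χc)
    (α : K) (hα : Algebra.norm F α = b)
    (fa : F) (hfa : fa ≠ 0)
    (A : K) (hA : A = algebraMap F K fa * ∏ i ∈ Finset.range (p - 1), (σa ^ i) (α ^ (p - 1 - i)))
    (rA : Fs) (hrA : rA ^ p = algebraMap K Fs A)
    (χA : (Fs ≃ₐ[F] Fs) → ZMod p)
    (hχA : ∀ σ : Fs ≃ₐ[F] Fs, χa σ = 0 → σ rA = algebraMap F Fs ξ ^ ((χA σ).val) * rA)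
    (φab : (Fs ≃ₐ[F] Fs) → ZMod p) (hφab_cts : Cts φab)
    (hφab : ∀ σ τ : Fs ≃ₐ[F] Fs, φab σ + φab τ - φab (σ * τ) = χa σ * χb τ)
    (hφab_res : ∀ σ : Fs ≃ₐ[F] Fs, χa σ = 0 → φab σ = -χA σ)
    (φbc : (Fs ≃ₐ[F] Fs) → ZMod p) (hφbc_cts : Cts φbc)
    (hφbc : ∀ σ τ : Fs ≃ₐ[F] Fs, φbc σ + φbc τ - φbc (σ * τ) = χb σ * χc τ) :
    ∃ ψ : (Fs ≃ₐ[F] Fs) → ZMod p,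
      (∀ x : ZMod p, IsOpen {σ : Fs ≃ₐ[F] Fs | χa σ = 0 ∧ ψ σ = x}) ∧
      (∀ σ τ : Fs ≃ₐ[F] Fs, χa σ = 0 → χa τ = 0 →
        (χa σ * φbc τ + φab σ * χc τ) - χc σ * χA τ = ψ σ + ψ τ - ψ (σ * τ)) := by
  have hrc0 : rc ≠ 0 := by
    rintro rfl
    rw [zero_pow (NeZero.ne p), eq_comm, map_eq_zero] at hrc
    exact hc hrc
  refine ⟨fun σ => -(φab σ * χc σ), fun x => ?_, fun σ τ hσ hτ => ?_⟩
  · exact (hχa_cts 0).inter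
      ((hφab_cts.isLocallyConstant.mul hχc_cts.isLocallyConstant).neg.isOpen_fiber x)
  · have hχcmul := hχc.apply_mul hξ hrc0 σ τ
    have hφmul : φab (σ * τ) = φab σ + φab τ := by
      have := hφab σ τ
      rw [hσ, zero_mul, sub_eq_zero] at this
      exact this.symm
    have hχAτ : χA τ = -φab τ := by rw [hφab_res τ hτ, neg_neg]
    simp only [hσ, hχAτ, hχcmul, hφmul]
    ring
end

section
/- Let F contain a primitive p-th root of unity, let a, b ∈ F^× be linearly independent modulo (F^×)^p, let k < p be a positive integer, and assume χ_a ∪ χ_b is the coboundary of a continuous 1-cochain on G_F. Then there exists a complete defining system {a_{ij} : 1 ≤ i < j ≤ k+2} for the (k+1)-tuple (−χ_b, −χ_a, …, −χ_a) (k copies of −χ_a) such that a_{ij} = −(χ_a choose j−i) for all 2 ≤ i < j ≤ k+2; in particular the (k+1)-fold Massey product ⟨−χ_b, −χ_a, …, −χ_a⟩ is defined and contains 0. -/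
/-- `(x choose m) = x(x−1)⋯(x−m+1)/m!` computed in `ZMod p`. -/
noncomputable def zchoose {p : ℕ} [Fact p.Prime] (x : ZMod p) (m : ℕ) : ZMod p :=
  (∏ j ∈ Finset.range m, (x - (j : ZMod p))) / (m.factorial : ZMod p)

/-- `M = {M i j : 1 ≤ i < j ≤ n+1}` is a complete defining system for the `n`-tuple
`(a 1, …, a n)`. -/
def IsCompleteDefiningSystem {G : Type*} [Group G] [TopologicalSpace G] {p : ℕ}
    (n : ℕ) (a : ℕ → G → ZMod p) (M : ℕ → ℕ → G → ZMod p) : Prop :=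
  (∀ i j, 1 ≤ i → i < j → j ≤ n + 1 → Cts (M i j)) ∧
  (∀ i, 1 ≤ i → i ≤ n → M i (i + 1) = a i) ∧
  (∀ i j, 1 ≤ i → i + 1 < j → j ≤ n + 1 → ∀ σ τ : G,
    M i j σ + M i j τ - M i j (σ * τ) = ∑ l ∈ Finset.Ico (i + 1) j, M i l σ * M l j τ)

open Filter Topology

section Zchoose

variable {p : ℕ} [Fact p.Prime]

theorem zchoose_zero (x : ZMod p) : zchoose x 0 = 1 := by simp [zchoose]

theorem zchoose_one (x : ZMod p) : zchoose x 1 = x := by simp [zchoose]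

theorem zchoose_natCast (n : ℕ) {m : ℕ} (hm : m < p) :
    zchoose (n : ZMod p) m = (n.choose m : ZMod p) := by
  have hf : (m.factorial : ZMod p) ≠ 0 := by
    rw [Ne, ZMod.natCast_eq_zero_iff, (Fact.out : p.Prime).dvd_factorial]
    exact not_le.mpr hm
  rw [zchoose, div_eq_iff hf, ← descPochhammer_eval_eq_prod_range,
    descPochhammer_eval_eq_descFactorial, Nat.descFactorial_eq_factorial_mul_choose]
  push_cast
  ring

/-- Vandermonde's identity in degree less than `p`. -/
theorem zchoose_add (x y : ZMod p) {m : ℕ} (hm : m < p) :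
    zchoose (x + y) m = ∑ l ∈ Finset.range (m + 1), zchoose x l * zchoose y (m - l) := by
  have hx := ZMod.natCast_zmod_val x
  have hy := ZMod.natCast_zmod_val y
  rw [← hx, ← hy, ← Nat.cast_add, zchoose_natCast _ hm, Nat.add_choose_eq,
    Finset.Nat.sum_antidiagonal_eq_sum_range_succ_mk]
  push_cast
  refine Finset.sum_congr rfl fun l hl => ?_
  rw [Finset.mem_range] at hl
  rw [zchoose_natCast _ (by omega), zchoose_natCast _ (by omega)]

end Zchoose

section RootPow

variable {p : ℕ} [Fact p.Prime] {L : Type*} [Field L]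

/-- The power of a `p`-th root of unity with exponent in `ZMod p`. -/
def rootPow (ζ : L) (x : ZMod p) : L := ζ ^ x.val

variable {ζ : L}

theorem rootPow_zero : rootPow ζ (0 : ZMod p) = 1 := by simp [rootPow]

theorem rootPow_add (hζ : IsPrimitiveRoot ζ p) (x y : ZMod p) :
    rootPow ζ (x + y) = rootPow ζ x * rootPow ζ y := by
  rw [rootPow, rootPow, rootPow, ← pow_add, ZMod.val_add, ← pow_eq_pow_mod _ hζ.pow_eq_one]

theorem rootPow_ne_zero (hζ : IsPrimitiveRoot ζ p) (x : ZMod p) : rootPow ζ x ≠ 0 :=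
  pow_ne_zero _ (hζ.ne_zero (Fact.out : p.Prime).ne_zero)

theorem rootPow_injective (hζ : IsPrimitiveRoot ζ p) :
    Function.Injective (rootPow ζ : ZMod p → L) := fun x y h =>
  ZMod.val_injective p (hζ.pow_inj (ZMod.val_lt x) (ZMod.val_lt y) h)

theorem rootPow_sum (hζ : IsPrimitiveRoot ζ p) {ι : Type*} (s : Finset ι) (f : ι → ZMod p) :
    rootPow ζ (∑ i ∈ s, f i) = ∏ i ∈ s, rootPow ζ (f i) := by
  classical
  induction s using Finset.induction_on with
  | empty => simp [rootPow_zero]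
  | insert i s hi ih => rw [Finset.sum_insert hi, Finset.prod_insert hi, rootPow_add hζ, ih]

theorem exists_rootPow_eq_of_pow_eq_one (hζ : IsPrimitiveRoot ζ p) {z : L}
    (hz : z ^ p = 1) : ∃ x : ZMod p, rootPow ζ x = z := by
  have : NeZero p := ⟨(Fact.out : p.Prime).ne_zero⟩
  obtain ⟨i, hi, rfl⟩ := hζ.eq_pow_of_pow_eq_one hz
  exact ⟨i, by rw [rootPow, ZMod.val_natCast_of_lt hi]⟩

end RootPow

theorem map_rootPow {p : ℕ} {F L : Type*} [Field F] [Field L] [Algebra F L] (ξ : F)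
    (σ : L ≃ₐ[F] L) (x : ZMod p) :
    σ (rootPow (algebraMap F L ξ) x) = rootPow (algebraMap F L ξ) x := by
  simp [rootPow]

section Galois

variable {p : ℕ} [Fact p.Prime] {F L : Type*} [Field F] [Field L] [Algebra F L]

/-- A Kummer character is additive. -/
theorem IsKummerChar.map_mul {ξ : F} (hξ : IsPrimitiveRoot (algebraMap F L ξ) p) {r : L}
    (hr : r ≠ 0) {χ : (L ≃ₐ[F] L) → ZMod p} (hχ : IsKummerChar ξ r χ) (σ τ : L ≃ₐ[F] L) :
    χ (σ * τ) = χ σ + χ τ := by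
  have h : ∀ ρ : L ≃ₐ[F] L, ρ r = rootPow (algebraMap F L ξ) (χ ρ) * r := hχ
  apply rootPow_injective hξ
  apply mul_right_cancel₀ hr
  rw [← h, AlgEquiv.mul_apply, h τ, _root_.map_mul, map_rootPow, h σ, rootPow_add hξ]
  ring

theorem IsKummerChar.surjective [IsGalois F L] {ξ : F}
    (hξ : IsPrimitiveRoot (algebraMap F L ξ) p) {r : L}
    (hr : r ∉ Set.range (algebraMap F L))
    {χ : (L ≃ₐ[F] L) → ZMod p} (hχ : IsKummerChar ξ r χ) : Function.Surjective χ := by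
  have hr0 : r ≠ 0 := fun h => hr ⟨0, by simp [h]⟩
  have hmul := hχ.map_mul hξ hr0
  have hone : χ 1 = 0 := by simpa using hmul 1 1
  obtain ⟨σ, hσ⟩ : ∃ σ, χ σ ≠ 0 := by
    by_contra! h
    refine hr ((InfiniteGalois.mem_range_algebraMap_iff_fixed r).mpr fun σ => ?_)
    have := hχ σ
    simpa [h σ] using this
  have hpow : ∀ n : ℕ, χ (σ ^ n) = n * χ σ := by
    intro n
    induction n with
    | zero => simp [hone]
    | succ n ih => rw [pow_succ, hmul, ih]; push_cast; ring
  intro x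
  refine ⟨σ ^ (x * (χ σ)⁻¹).val, ?_⟩
  rw [hpow, ZMod.natCast_zmod_val, mul_assoc, inv_mul_cancel₀ hσ, mul_one]

/-- Every homomorphism to `ZMod p` with open kernel on an open subgroup `N` of the Galois group
is the Kummer character on `N` of some nonzero element. -/
theorem exists_kummer_generator [IsGalois F L] {ξ : F}
    (hξ : IsPrimitiveRoot (algebraMap F L ξ) p)
    (N : Subgroup (L ≃ₐ[F] L)) (hN : IsOpen (N : Set (L ≃ₐ[F] L)))
    (h : (L ≃ₐ[F] L) → ZMod p) (hcts : Cts h)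
    (hmul : ∀ σ ∈ N, ∀ τ ∈ N, h (σ * τ) = h σ + h τ) :
    ∃ w : L, w ≠ 0 ∧ ∀ τ ∈ N, τ w = rootPow (algebraMap F L ξ) (h τ) * w := by
  by_cases htriv : ∀ τ ∈ N, h τ = 0
  · exact ⟨1, one_ne_zero, fun τ hτ => by simp [htriv τ hτ, rootPow_zero]⟩
  push Not at htriv
  obtain ⟨τ₀, hτ₀, hne⟩ := htriv
  have hone : h 1 = 0 := by simpa using hmul 1 N.one_mem 1 N.one_mem
  have hinv : ∀ σ ∈ N, h σ⁻¹ = - h σ := fun σ hσ => by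
    have := hmul σ⁻¹ (N.inv_mem hσ) σ hσ
    rw [inv_mul_cancel, hone] at this
    exact eq_neg_of_add_eq_zero_left this.symm
  have hpow : ∀ n : ℕ, h (τ₀ ^ n) = n * h τ₀ := by
    intro n
    induction n with
    | zero => simp [hone]
    | succ n ih => rw [pow_succ, hmul _ (N.pow_mem hτ₀ n) _ hτ₀, ih]; push_cast; ring
  obtain ⟨t, htN, ht⟩ : ∃ t : ZMod p → (L ≃ₐ[F] L), (∀ j, t j ∈ N) ∧ ∀ j, h (t j) = j :=
    ⟨fun j => τ₀ ^ (j * (h τ₀)⁻¹).val, fun j => N.pow_mem hτ₀ _, fun j => by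
      rw [hpow, ZMod.natCast_zmod_val, mul_assoc, inv_mul_cancel₀ hne, mul_one]⟩
  let M : Subgroup (L ≃ₐ[F] L) :=
    { carrier := {σ | σ ∈ N ∧ h σ = 0}
      mul_mem' := fun {σ τ} hσ hτ => ⟨N.mul_mem hσ.1 hτ.1, by
        rw [hmul _ hσ.1 _ hτ.1, hσ.2, hτ.2, add_zero]⟩
      one_mem' := ⟨N.one_mem, hone⟩
      inv_mem' := fun {σ} hσ => ⟨N.inv_mem hσ.1, by rw [hinv _ hσ.1, hσ.2, neg_zero]⟩ }
  have hM : IsOpen (M : Set (L ≃ₐ[F] L)) := hN.inter (hcts 0)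
  let E := IntermediateField.fixedField M
  have hfix : E.fixingSubgroup = M :=
    InfiniteGalois.fixingSubgroup_fixedField
      ⟨M, OpenSubgroup.isClosed (⟨M, hM⟩ : OpenSubgroup (L ≃ₐ[F] L))⟩
  have hdiff : ∀ σ ∈ N, ∀ τ ∈ N, h σ = h τ → σ⁻¹ * τ ∈ M := fun σ hσ τ hτ hst =>
    ⟨N.mul_mem (N.inv_mem hσ) hτ, by
      rw [hmul _ (N.inv_mem hσ) _ hτ, hinv _ hσ, hst, neg_add_cancel]⟩
  have hagree : ∀ σ ∈ N, ∀ τ ∈ N, h σ = h τ → ∀ x : E, σ x = τ x := by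
    intro σ hσ τ hτ hst x
    have h1 : (σ⁻¹ * τ) (x : L) = x := x.2 ⟨_, hdiff σ hσ τ hτ hst⟩
    have h2 := congrArg σ h1
    rw [← AlgEquiv.mul_apply, mul_inv_cancel_left] at h2
    exact h2.symm
  let f : ZMod p → (E →* L) := fun j => (t j : L →* L).comp (algebraMap E L : E →* L)
  have hf : Function.Injective f := by
    intro i j hij
    have hmem : (t i)⁻¹ * t j ∈ E.fixingSubgroup := by
      rw [IntermediateField.mem_fixingSubgroup_iff]
      intro x hx
      have h1 : t i x = t j x := DFunLike.congr_fun hij (⟨x, hx⟩ : E)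
      rw [AlgEquiv.mul_apply, ← h1, ← AlgEquiv.mul_apply, inv_mul_cancel, AlgEquiv.one_apply]
    rw [hfix] at hmem
    have h2 := hmem.2
    rw [hmul _ (N.inv_mem (htN i)) _ (htN j), hinv _ (htN i), ht, ht] at h2
    exact (neg_add_eq_zero.mp h2)
  have hli := (linearIndependent_monoidHom E L).comp f hf
  obtain ⟨x, hx⟩ : ∃ x : E, ∑ j, rootPow (algebraMap F L ξ) (-j) * t j x ≠ 0 := by
    by_contra! hzero
    have := Fintype.linearIndependent_iff.mp hli
      (fun j => rootPow (algebraMap F L ξ) (-j)) (by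
        funext x
        simpa [f] using hzero x) 0
    exact rootPow_ne_zero hξ _ this
  refine ⟨_, hx, fun τ hτ => ?_⟩
  rw [map_sum, Finset.mul_sum, ← Equiv.sum_comp (Equiv.addRight (h τ))
    (fun j => rootPow (algebraMap F L ξ) (h τ) * (rootPow (algebraMap F L ξ) (-j) * t j x))]
  refine Finset.sum_congr rfl fun j _ => ?_
  rw [_root_.map_mul, map_rootPow, ← AlgEquiv.mul_apply, ← mul_assoc, ← rootPow_add hξ,
    Equiv.coe_addRight, hagree (τ * t j) (N.mul_mem hτ (htN j)) (t (j + h τ)) (htN _)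
      (by rw [hmul _ hτ _ (htN j), ht, ht, add_comm])]
  congr 2
  ring

/-- If the cup product of two Kummer characters is a coboundary, then `rb ^ p` is the product of
a family of elements permuted by the Galois group through translation by `χa`. -/
theorem exists_conjugates_prod_eq [IsGalois F L] {ξ : F}
    (hξ : IsPrimitiveRoot (algebraMap F L ξ) p) {rb : L} (hrb : rb ≠ 0)
    {χa χb φ : (L ≃ₐ[F] L) → ZMod p} (hsurj : Function.Surjective χa)
    (hχa : ∀ σ τ, χa (σ * τ) = χa σ + χa τ) (hχb : IsKummerChar ξ rb χb)
    (hχa_cts : Cts χa) (hφ_cts : Cts φ)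
    (hφ : ∀ σ τ, φ σ + φ τ - φ (σ * τ) = χa σ * χb τ) :
    ∃ β : ZMod p → L, (∀ i, β i ≠ 0) ∧ (∀ σ i, σ (β i) = β (i + χa σ)) ∧
      ∏ i, β i = rb ^ p := by
  have hχb_mul := hχb.map_mul hξ hrb
  have hone : χa 1 = 0 := by simpa using hχa 1 1
  let N : Subgroup (L ≃ₐ[F] L) :=
    { carrier := {σ | χa σ = 0}
      mul_mem' := fun {σ τ} hσ hτ => by
        simp only [Set.mem_ofPred_eq] at *
        rw [hχa, hσ, hτ, add_zero]
      one_mem' := hone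
      inv_mem' := fun {σ} hσ => by
        have := hχa σ⁻¹ σ
        simp only [Set.mem_ofPred_eq] at *
        rw [inv_mul_cancel, hone, hσ, add_zero] at this
        exact this.symm }
  have hmemN : ∀ σ, σ ∈ N ↔ χa σ = 0 := fun σ => Iff.rfl
  let h : (L ≃ₐ[F] L) → ZMod p := fun σ => -φ σ - χa σ * χb σ
  have hh : ∀ σ τ, h (σ * τ) = h σ + h τ - χa τ * χb σ := by
    intro σ τ
    simp only [h, hχa, hχb_mul]
    linear_combination hφ σ τ
  obtain ⟨w₀, hw₀, hNw⟩ := exists_kummer_generator hξ N (hχa_cts 0) (fun σ => -φ σ)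
    (fun x => by
      convert hφ_cts (-x) using 1
      ext σ
      simp [neg_eq_iff_eq_neg])
    (fun σ hσ τ _ => by
      have := hφ σ τ
      rw [(hmemN σ).mp hσ] at this
      linear_combination this)
  choose s hs using hsurj
  let w : ZMod p → L := fun i => rootPow (algebraMap F L ξ) (-h (s i)) * s i w₀
  have hw : ∀ σ, rootPow (algebraMap F L ξ) (-h σ) * σ w₀ = w (χa σ) := by
    intro σ
    obtain ⟨τ, hτ⟩ : ∃ τ, σ = s (χa σ) * τ := ⟨(s (χa σ))⁻¹ * σ, by simp⟩
    have hτN : χa τ = 0 := by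
      have := congrArg χa hτ
      rw [hχa, hs] at this
      exact left_eq_add.mp this
    have h1 : -φ τ = h τ := by simp [h, hτN]
    have h2 : h σ = h (s (χa σ)) + h τ := by
      conv_lhs => rw [hτ]
      rw [hh, hτN]; ring
    have h3 : σ w₀ = rootPow (algebraMap F L ξ) (h τ) * s (χa σ) w₀ := by
      conv_lhs => rw [hτ]
      rw [AlgEquiv.mul_apply, hNw τ ((hmemN τ).mpr hτN), _root_.map_mul, map_rootPow, h1]
    rw [h2, h3, ← mul_assoc, ← rootPow_add hξ]
    simp [w]
  have hw0 : ∀ i, w i ≠ 0 := fun i =>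
    mul_ne_zero (rootPow_ne_zero hξ _) (by simpa using hw₀)
  have hσw : ∀ σ i, σ (w i) =
      rootPow (algebraMap F L ξ) (h σ - i * χb σ) * w (i + χa σ) := by
    intro σ i
    have h1 := hw (σ * s i)
    rw [hχa, hs, hh, hs] at h1
    rw [add_comm i, ← h1, ← mul_assoc, ← rootPow_add hξ]
    simp only [w]
    rw [_root_.map_mul, map_rootPow, AlgEquiv.mul_apply]
    congr 2
    ring
  refine ⟨fun i => rb * w (i + 1) / w i, fun i => div_ne_zero (mul_ne_zero hrb (hw0 _)) (hw0 _),
    fun σ i => ?_, ?_⟩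
  · have hσrb : σ rb = rootPow (algebraMap F L ξ) (χb σ) * rb := hχb σ
    have hexp : rootPow (algebraMap F L ξ) (h σ - i * χb σ) =
        rootPow (algebraMap F L ξ) (χb σ) *
          rootPow (algebraMap F L ξ) (h σ - (i + 1) * χb σ) := by
      rw [← rootPow_add hξ]
      congr 1
      ring
    have e0 := rootPow_ne_zero hξ (h σ - (i + 1) * χb σ)
    have e1 := rootPow_ne_zero hξ (χb σ)
    have e2 := hw0 (i + χa σ)
    rw [map_div₀, _root_.map_mul, hσw, hσw, hσrb, hexp, add_right_comm i 1]
    field_simp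
  · have hshift : ∏ i, w (i + 1) = ∏ i, w i := Equiv.prod_comp (Equiv.addRight 1) w
    rw [Finset.prod_div_distrib, Finset.prod_mul_distrib, hshift,
      mul_div_cancel_right₀ _ (Finset.prod_ne_zero_iff.mpr fun i _ => hw0 i)]
    simp [ZMod.card]

theorem eventually_apply_eq [Algebra.IsIntegral F L] (σ : L ≃ₐ[F] L) (x : L) :
    ∀ᶠ τ in 𝓝 σ, τ x = σ x := by
  have h := (stabilizer_isOpen_of_isIntegral (K := F) x).leftCoset σ
  refine Filter.mem_of_superset (h.mem_nhds ⟨1, one_mem _, mul_one σ⟩) ?_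
  rintro _ ⟨τ, hτ, rfl⟩
  exact congrArg σ hτ

/-- A Galois-permuted family of elements has a Kummer cocycle with values in the induced module,
whose sum is the Kummer character of the product. -/
theorem exists_induced_kummer_cocycle [IsSepClosure F L] {ξ : F}
    (hξ : IsPrimitiveRoot (algebraMap F L ξ) p) {rb : L}
    {χa χb : (L ≃ₐ[F] L) → ZMod p}
    (hχa : ∀ σ τ, χa (σ * τ) = χa σ + χa τ) (hχb : IsKummerChar ξ rb χb)
    (hχa_cts : Cts χa) {β : ZMod p → L} (hβ0 : ∀ i, β i ≠ 0)
    (hβ : ∀ σ i, σ (β i) = β (i + χa σ)) (hprod : ∏ i, β i = rb ^ p) :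
    ∃ g : (L ≃ₐ[F] L) → ZMod p → ZMod p,
      (∀ σ τ i, g (σ * τ) i = g τ i + g σ (i + χa τ)) ∧
      (∀ σ, ∑ i, g σ i = χb σ) ∧ IsLocallyConstant g := by
  have hp : p ≠ 0 := (Fact.out : p.Prime).ne_zero
  have : NeZero p := ⟨hp⟩
  have : NeZero (p : L) := hξ.neZero'
  have : IsSepClosed L := IsSepClosure.sep_closed F
  choose r hr using fun i => IsSepClosed.exists_pow_nat_eq (β i) p
  have hr0 : ∀ i, r i ≠ 0 := fun i h => hβ0 i (by rw [← hr i, h, zero_pow hp])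
  have hex : ∀ σ i, ∃ x : ZMod p, rootPow (algebraMap F L ξ) x = σ (r i) / r (i + χa σ) := by
    intro σ i
    apply exists_rootPow_eq_of_pow_eq_one hξ
    rw [div_pow, ← map_pow, hr, hr, hβ, div_self (hβ0 _)]
  choose g hg using hex
  have hg' : ∀ σ i, σ (r i) = rootPow (algebraMap F L ξ) (g σ i) * r (i + χa σ) := fun σ i => by
    rw [hg, div_mul_cancel₀ _ (hr0 _)]
  refine ⟨g, fun σ τ i => ?_, fun σ => ?_, ?_⟩
  · apply rootPow_injective hξ
    apply mul_right_cancel₀ (hr0 (i + χa (σ * τ)))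
    rw [← hg', AlgEquiv.mul_apply, hg' τ, _root_.map_mul, map_rootPow, hg' σ, rootPow_add hξ, hχa,
      add_comm (χa σ), add_assoc]
    ring
  · have hrb0 : rb ≠ 0 := by
      rintro rfl
      rw [zero_pow hp] at hprod
      exact Finset.prod_ne_zero_iff.mpr (fun i _ => hβ0 i) hprod
    obtain ⟨c, hc⟩ := exists_rootPow_eq_of_pow_eq_one hξ (z := (∏ i, r i) / rb) (by
      rw [div_pow, ← Finset.prod_pow, Finset.prod_congr rfl fun i _ => hr i, hprod,
        div_self (pow_ne_zero _ hrb0)])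
    have hR : ∏ i, r i = rootPow (algebraMap F L ξ) c * rb := by
      rw [hc, div_mul_cancel₀ _ hrb0]
    have hR0 : ∏ i, r i ≠ 0 := Finset.prod_ne_zero_iff.mpr fun i _ => hr0 i
    have hshift : ∏ i, r (i + χa σ) = ∏ i, r i := Equiv.prod_comp (Equiv.addRight (χa σ)) r
    have h1 : σ (∏ i, r i) = rootPow (algebraMap F L ξ) (∑ i, g σ i) * ∏ i, r i := by
      rw [map_prod, Finset.prod_congr rfl fun i _ => hg' σ i, Finset.prod_mul_distrib,
        rootPow_sum hξ, hshift]
    have h2 : σ (∏ i, r i) = rootPow (algebraMap F L ξ) (χb σ) * ∏ i, r i := by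
      have hσrb : σ rb = rootPow (algebraMap F L ξ) (χb σ) * rb := hχb σ
      rw [hR, _root_.map_mul, map_rootPow, hσrb]
      ring
    exact rootPow_injective hξ (mul_right_cancel₀ hR0 (h1.symm.trans h2))
  · rw [IsLocallyConstant.iff_eventually_eq]
    intro σ
    have h1 : ∀ᶠ τ in 𝓝 σ, χa τ = χa σ := (hχa_cts (χa σ)).mem_nhds rfl
    have h2 : ∀ᶠ τ in 𝓝 σ, ∀ i, τ (r i) = σ (r i) :=
      eventually_all.mpr fun i => eventually_apply_eq σ (r i)
    filter_upwards [h1, h2] with τ hτ1 hτ2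
    funext i
    apply rootPow_injective hξ
    rw [hg, hg, hτ1, hτ2]

end Galois

theorem Cts.comp_left {G : Type*} [TopologicalSpace G] {p : ℕ} {f : G → ZMod p} (hf : Cts f)
    (u : ZMod p → ZMod p) : Cts (fun σ => u (f σ)) := fun x => by
  have : (fun σ => u (f σ)) ⁻¹' {x} = ⋃ y ∈ u ⁻¹' {x}, f ⁻¹' {y} := by
    ext
    simp
  rw [this]
  exact isOpen_biUnion fun y _ => hf y

/-- An induced cocycle over an additive character `χ` with sum `ψ` yields a complete defining
system for `(-ψ, -χ, …, -χ)`. -/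
theorem exists_completeDefiningSystem_of_induced_cocycle {G : Type*} [Group G]
    [TopologicalSpace G] {p : ℕ} [Fact p.Prime] {χ ψ : G → ZMod p} {g : G → ZMod p → ZMod p}
    (hχ : ∀ σ τ, χ (σ * τ) = χ σ + χ τ) (hχ_cts : Cts χ)
    (hg : ∀ σ τ i, g (σ * τ) i = g τ i + g σ (i + χ τ))
    (hsum : ∀ σ, ∑ i, g σ i = ψ σ) (hg_cts : IsLocallyConstant g) {k : ℕ} (hkp : k < p) :
    ∃ M : ℕ → ℕ → G → ZMod p,
      IsCompleteDefiningSystem (k + 1) (fun i σ => if i = 1 then -ψ σ else -χ σ) M ∧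
      ∀ i j, 2 ≤ i → i < j → j ≤ k + 2 → M i j = fun σ => -(zchoose (χ σ) (j - i)) := by
  let M : ℕ → ℕ → G → ZMod p := fun i j σ =>
    if i = 1 then -∑ x, g σ x * zchoose (-x) (j - 2) else -zchoose (χ σ) (j - i)
  have hM1 : ∀ j σ, M 1 j σ = -∑ x, g σ x * zchoose (-x) (j - 2) := fun j σ => if_pos rfl
  have hM2 : ∀ i j σ, 2 ≤ i → M i j σ = -zchoose (χ σ) (j - i) := fun i j σ hi =>
    if_neg (by omega)
  refine ⟨M, ⟨fun i j hi _ _ => ?_, fun i hi _ => ?_, fun i j hi hij hj σ τ => ?_⟩,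
    fun i j hi _ _ => funext fun σ => hM2 i j σ hi⟩
  · rcases hi.eq_or_lt with rfl | hi
    · rw [funext (hM1 j)]
      exact fun x => hg_cts.comp (fun v => -∑ x, v x * zchoose (-x) (j - 2)) {x}
    · rw [funext fun σ => hM2 i j σ hi]
      exact hχ_cts.comp_left fun x => -zchoose x (j - i)
  · funext σ
    rcases hi.eq_or_lt with rfl | hi
    · simp [hM1, zchoose_zero, hsum]
    · have hi1 : i ≠ 1 := hi.ne'
      simp [hM2 i _ σ hi, hi1, zchoose_one]
  · rcases hi.eq_or_lt with rfl | hi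
    · obtain ⟨m, rfl⟩ : ∃ m, j = m + 3 := ⟨j - 3, by omega⟩
      have hR : ∑ l ∈ Finset.Ico (1 + 1) (m + 3), M 1 l σ * M l (m + 3) τ =
          ∑ l ∈ Finset.range (m + 1),
            (∑ x, g σ x * zchoose (-x) l) * zchoose (χ τ) (m + 1 - l) := by
        rw [Finset.sum_Ico_eq_sum_range]
        refine Finset.sum_congr rfl fun l _ => ?_
        rw [hM1, hM2 _ _ _ (by omega), neg_mul_neg, show 1 + 1 + l - 2 = l by omega,
          show m + 3 - (1 + 1 + l) = m + 1 - l by omega]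
      have hshift : ∑ x, g σ (x + χ τ) * zchoose (-x) (m + 1) =
          ∑ x, g σ x * zchoose (-x + χ τ) (m + 1) := by
        rw [← Equiv.sum_comp (Equiv.addRight (χ τ))
          fun x => g σ x * zchoose (-x + χ τ) (m + 1)]
        refine Finset.sum_congr rfl fun x _ => ?_
        simp
      have hvan : ∑ x, g σ x * zchoose (-x + χ τ) (m + 1) =
          ∑ l ∈ Finset.range (m + 1 + 1),
            (∑ x, g σ x * zchoose (-x) l) * zchoose (χ τ) (m + 1 - l) := by
        have hm : m + 1 < p := by omega
        simp_rw [zchoose_add _ _ hm, Finset.mul_sum, Finset.sum_mul]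
        rw [Finset.sum_comm]
        simp_rw [mul_assoc]
      rw [Finset.sum_range_succ, Nat.sub_self, zchoose_zero, mul_one] at hvan
      rw [hR, hM1, hM1, hM1]
      simp only [hg, add_mul, Finset.sum_add_distrib, show m + 3 - 2 = m + 1 by omega]
      rw [hshift, hvan]
      ring
    · obtain ⟨m, rfl⟩ : ∃ m, j = i + m + 2 := ⟨j - i - 2, by omega⟩
      have hR : ∑ l ∈ Finset.Ico (i + 1) (i + m + 2), M i l σ * M l (i + m + 2) τ =
          ∑ l ∈ Finset.range (m + 1),
            zchoose (χ σ) (l + 1) * zchoose (χ τ) (m + 2 - (l + 1)) := by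
        rw [Finset.sum_Ico_eq_sum_range]
        refine Finset.sum_congr (by congr 1; omega) fun l _ => ?_
        rw [hM2 _ _ _ hi, hM2 _ _ _ (by omega), neg_mul_neg]
        congr 2 <;> omega
      have hvan := zchoose_add (χ σ) (χ τ) (m := m + 2) (by omega)
      rw [Finset.sum_range_succ, Finset.sum_range_succ', Nat.sub_self, Nat.sub_zero,
        zchoose_zero, zchoose_zero, mul_one, one_mul] at hvan
      rw [hR, hM2 _ _ _ hi, hM2 _ _ _ hi, hM2 _ _ _ hi, hχ,
        show i + m + 2 - i = m + 2 by omega, hvan]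
      ring

theorem LinIndepModP.not_mem_range {p : ℕ} [Fact p.Prime] {F L : Type*} [Field F] [Field L]
    [Algebra F L] {a b : F} (ha : a ≠ 0) (hab : LinIndepModP p a b) {r : L}
    (hr : r ^ p = algebraMap F L a) : r ∉ Set.range (algebraMap F L) := by
  rintro ⟨y, rfl⟩
  have hy : y ^ p = a := (algebraMap F L).injective (by rw [map_pow, hr])
  have hp := (Fact.out : p.Prime)
  have hy0 : y ≠ 0 := by
    rintro rfl
    exact ha (by rw [← hy, zero_pow hp.ne_zero])
  have h := (hab 1 0 ⟨y, hy0, by simp [hy]⟩).1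
  exact hp.one_lt.ne' (by exact_mod_cast Int.eq_one_of_dvd_one (by positivity) h)

/-- Let `F` be a field containing a primitive `p`-th root of unity, `a, b ∈ F^×`
linearly independent modulo `(F^×)^p` with Kummer characters `χ_a, χ_b`, `k < p` a
positive integer, and assume `χ_a ∪ χ_b` is the coboundary of a continuous 1-cochain.
Then there is a complete defining system `{a_{ij} : 1 ≤ i < j ≤ k+2}` for the
`(k+1)`-tuple `(−χ_b, −χ_a, …, −χ_a)` (`k` copies of `−χ_a`) with
`a_{ij} = −(χ_a choose (j−i))` for all `2 ≤ i < j ≤ k+2`; in particular the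
`(k+1)`-fold Massey product `⟨−χ_b, −χ_a, …, −χ_a⟩` is defined and contains `0`. -/
theorem massey_baa_complete_defining_system (p : ℕ) [Fact p.Prime]
    (F Fs : Type*) [Field F] [Field Fs] [Algebra F Fs] [IsSepClosure F Fs]
    (ξ : F) (hξ : IsPrimitiveRoot ξ p)
    (a b : F) (ha : a ≠ 0) (hb : b ≠ 0) (hab : LinIndepModP p a b)
    (ra rb : Fs) (hra : ra ^ p = algebraMap F Fs a) (hrb : rb ^ p = algebraMap F Fs b)
    (χa χb : (Fs ≃ₐ[F] Fs) → ZMod p)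
    (hχa : IsKummerChar ξ ra χa) (hχb : IsKummerChar ξ rb χb)
    (hχa_cts : Cts χa) (hχb_cts : Cts χb)
    (k : ℕ) (hk1 : 1 ≤ k) (hkp : k < p)
    (hcup : ∃ φ : (Fs ≃ₐ[F] Fs) → ZMod p, Cts φ ∧
      ∀ σ τ : Fs ≃ₐ[F] Fs, φ σ + φ τ - φ (σ * τ) = χa σ * χb τ) :
    ∃ M : ℕ → ℕ → (Fs ≃ₐ[F] Fs) → ZMod p,
      IsCompleteDefiningSystem (k + 1)
        (fun i σ => if i = 1 then -χb σ else -χa σ) M ∧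
      ∀ i j, 2 ≤ i → i < j → j ≤ k + 2 →
        M i j = fun σ => -(zchoose (χa σ) (j - i)) := by
  have hp : p ≠ 0 := (Fact.out : p.Prime).ne_zero
  have hζ : IsPrimitiveRoot (algebraMap F Fs ξ) p :=
    hξ.map_of_injective (algebraMap F Fs).injective
  have hrb0 : rb ≠ 0 := by
    rintro rfl
    rw [zero_pow hp] at hrb
    exact hb ((map_eq_zero _).mp hrb.symm)
  have hra_range := hab.not_mem_range ha hra
  have hra0 : ra ≠ 0 := fun h => hra_range ⟨0, by simp [h]⟩
  have hmul := hχa.map_mul hζ hra0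
  obtain ⟨φ, hφ_cts, hφ⟩ := hcup
  obtain ⟨β, hβ0, hβ, hprod⟩ := exists_conjugates_prod_eq hζ hrb0 (hχa.surjective hζ hra_range)
    hmul hχb hχa_cts hφ_cts hφ
  obtain ⟨g, hg, hsum, hg_cts⟩ :=
    exists_induced_kummer_cocycle hζ hmul hχb hχa_cts hβ0 hβ hprod
  exact exists_completeDefiningSystem_of_induced_cocycle hmul hχa_cts hg hsum hg_cts hkp
end
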